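/- arXiv:0903.2368 — 12 statements merged into one kernel-verified Lean document; each statement's English description precedes it below -/
import Mathlib

section
/- The function g : ℝ² → ℝ defined by g(x,y) = √(x⁴ + y⁴) is arc-analytic, i.e. for every real analytic curve γ : ℝ → ℝ², the composition g ∘ γ : ℝ → ℝ is real analytic. -/
/-- The function `g(x,y) = √(x⁴ + y⁴)` is arc-analytic: for every real analytic curve
`γ : ℝ → ℝ²`, the composition `g ∘ γ` is real analytic. -/
theorem stmt_2
    (g : ℝ × ℝ → ℝ)
    (hg : ∀ p : ℝ × ℝ, g p = Real.sqrt (p.1 ^ 4 + p.2 ^ 4))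
    (γ : ℝ → ℝ × ℝ) (hγ : ∀ t : ℝ, AnalyticAt ℝ γ t) :
    ∀ t : ℝ, AnalyticAt ℝ (g ∘ γ) t := by
  intro t
  by_cases h0 : ∀ᶠ z in nhds t, γ z = 0
  · refine (analyticAt_const (v := (0 : ℝ))).congr ?_
    filter_upwards [h0] with z hz
    simp [hg, hz]
  · obtain ⟨n, h, hh, hne, heq⟩ := (hγ t).exists_eventuallyEq_pow_smul_nonzero_iff.mpr h0
    have h1 : AnalyticAt ℝ (fun z => (h z).1) t := analyticAt_fst.comp hh
    have h2 : AnalyticAt ℝ (fun z => (h z).2) t := analyticAt_snd.comp hh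
    have hpos : (h t).1 ^ 4 + (h t).2 ^ 4 ≠ 0 := by
      intro hs
      have ha : 0 ≤ (h t).1 ^ 4 := by positivity
      have hb : 0 ≤ (h t).2 ^ 4 := by positivity
      apply hne
      ext
      · exact pow_eq_zero_iff (n := 4) (by norm_num) |>.mp (by linarith)
      · exact pow_eq_zero_iff (n := 4) (by norm_num) |>.mp (by linarith)
    have hS : AnalyticAt ℝ (fun z => (h z).1 ^ 4 + (h z).2 ^ 4) t := (h1.pow 4).add (h2.pow 4)
    have hsq : AnalyticAt ℝ (fun z => Real.sqrt ((h z).1 ^ 4 + (h z).2 ^ 4)) t :=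
      (hS.contDiffAt.sqrt hpos).analyticAt
    have hp : AnalyticAt ℝ (fun z : ℝ => ((z - t) ^ n) ^ 2) t := by fun_prop
    refine (hp.mul hsq).congr ?_
    filter_upwards [heq] with z hz
    simp only [Function.comp, hg, hz, Prod.smul_fst, Prod.smul_snd, smul_eq_mul, Pi.mul_apply]
    rw [show ((z - t) ^ n * (h z).1) ^ 4 + ((z - t) ^ n * (h z).2) ^ 4
      = (((z - t) ^ n) ^ 2) ^ 2 * ((h z).1 ^ 4 + (h z).2 ^ 4) by ring,
      Real.sqrt_mul (by positivity), Real.sqrt_sq (by positivity)]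
end

section
/- The function h : ℝ² → ℝ defined by h(x,y) = x·y⁵/(x⁴+y⁶) for (x,y) ≠ (0,0) and h(0,0) = 0 is arc-analytic, i.e. for every real analytic curve γ : ℝ → ℝ², the composition h ∘ γ : ℝ → ℝ is real analytic. -/
lemma h_bound (x y : ℝ) : |x * y ^ 5 / (x ^ 4 + y ^ 6)| ≤ √|y| := by
  apply Real.le_sqrt_of_sq_le
  rw [sq_abs]
  apply (pow_le_pow_iff_left₀ (by positivity) (abs_nonneg y) two_ne_zero).1
  rw [sq_abs]
  rcases eq_or_ne (x ^ 4 + y ^ 6) 0 with h0 | h0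
  · rw [h0]; simp; positivity
  have ha : 0 ≤ x ^ 4 := by positivity
  have hb : 0 ≤ y ^ 6 := by positivity
  have hp : 0 < x ^ 4 + y ^ 6 := lt_of_le_of_ne (by positivity) h0.symm
  have key : x ^ 4 * (y ^ 6) ^ 3 ≤ (x ^ 4 + y ^ 6) ^ 4 := by
    generalize x ^ 4 = a at *
    generalize y ^ 6 = b at *
    calc a * b ^ 3 ≤ (a + b) * (a + b) ^ 3 := by gcongr <;> linarith
      _ = _ := by ring
  rw [← pow_mul, div_pow, div_le_iff₀ (by positivity)]
  calc (x * y ^ 5) ^ (2 * 2) = y ^ 2 * (x ^ 4 * (y ^ 6) ^ 3) := by ring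
    _ ≤ _ := by gcongr

open Classical in
/-- The function `h(x,y) = x·y⁵/(x⁴+y⁶)` (with `h(0,0) = 0`) is arc-analytic: for every
real analytic curve `γ : ℝ → ℝ²`, the composition `h ∘ γ` is real analytic. -/
theorem stmt_4
    (h : ℝ × ℝ → ℝ)
    (hh : ∀ p : ℝ × ℝ, h p = if p = (0, 0) then 0 else p.1 * p.2 ^ 5 / (p.1 ^ 4 + p.2 ^ 6))
    (γ : ℝ → ℝ × ℝ) (hγ : ∀ t : ℝ, AnalyticAt ℝ γ t) :
    ∀ t : ℝ, AnalyticAt ℝ (h ∘ γ) t := by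
  intro t
  have hx : AnalyticAt ℝ (fun s => (γ s).1) t := analyticAt_fst.comp (hγ t)
  have hy : AnalyticAt ℝ (fun s => (γ s).2) t := analyticAt_snd.comp (hγ t)
  have e : h ∘ γ = fun s => (γ s).1 * (γ s).2 ^ 5 / ((γ s).1 ^ 4 + (γ s).2 ^ 6) := by
    funext s
    simp only [Function.comp, hh]
    split_ifs with h0
    · simp [h0]
    · rfl
  rw [e]
  have hn := hx.mul (hy.pow 5)
  have hd := (hx.pow 4).add (hy.pow 6)
  by_cases h0 : (γ t).1 ^ 4 + (γ t).2 ^ 6 = 0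
  · refine MeromorphicAt.analyticAt (hn.meromorphicAt.div hd.meromorphicAt) ?_
    have hy0 : (γ t).2 = 0 := by
      have h1 : 0 ≤ (γ t).1 ^ 4 := by positivity
      have h2 : 0 ≤ (γ t).2 ^ 6 := by positivity
      exact pow_eq_zero_iff (n := 6) (by norm_num) |>.1 (by linarith)
    have hlim : Filter.Tendsto (fun s => √|(γ s).2|) (nhds t) (nhds 0) := by
      have : ContinuousAt (fun s => √|(γ s).2|) t := hy.continuousAt.abs.sqrt
      simpa [ContinuousAt, hy0] using this
    show Filter.Tendsto (fun s => (γ s).1 * (γ s).2 ^ 5 / ((γ s).1 ^ 4 + (γ s).2 ^ 6)) _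
      (nhds ((γ t).1 * (γ t).2 ^ 5 / ((γ t).1 ^ 4 + (γ t).2 ^ 6)))
    rw [h0, div_zero]
    exact squeeze_zero_norm (fun s => h_bound _ _) hlim
  · exact hn.div hd h0
end

section
/- The function h : ℝ² → ℝ defined by h(x,y) = x·y⁵/(x⁴+y⁶) for (x,y) ≠ (0,0) and h(0,0) = 0 is not Lipschitz on any neighborhood of the origin: for every neighborhood U of (0,0) and every constant K ≥ 0, h restricted to U is not K-Lipschitz. -/
open Classical in
/-- The function `h(x,y) = x·y⁵/(x⁴+y⁶)` (with `h(0,0) = 0`) is not Lipschitz on any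
neighborhood of the origin: for every neighborhood `U` of `(0,0)` and every constant
`K ≥ 0`, the restriction of `h` to `U` is not `K`-Lipschitz. -/
theorem stmt_5
    (h : ℝ × ℝ → ℝ)
    (hh : ∀ p : ℝ × ℝ, h p = if p = (0, 0) then 0 else p.1 * p.2 ^ 5 / (p.1 ^ 4 + p.2 ^ 6)) :
    ∀ U ∈ nhds ((0, 0) : ℝ × ℝ), ∀ K : NNReal, ¬ LipschitzOnWith K h U := by
  intro U hU K hL
  have hc : Filter.Tendsto (fun t : ℝ => ((t ^ 3, t ^ 2) : ℝ × ℝ)) (nhdsWithin 0 (Set.Ioi 0))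
      (nhds (0, 0)) := by
    have : Continuous (fun t : ℝ => ((t ^ 3, t ^ 2) : ℝ × ℝ)) := by fun_prop
    have h2 := this.tendsto 0
    simp only [ne_eq, OfNat.ofNat_ne_zero, not_false_eq_true, zero_pow] at h2
    exact h2.mono_left nhdsWithin_le_nhds
  have hK : (0 : ℝ) < 1 / (2 * (K : ℝ) + 1) := by positivity
  have e2 : ∀ᶠ t : ℝ in nhdsWithin 0 (Set.Ioi 0), t ∈ Set.Ioo (0 : ℝ) (1 / (2 * (K : ℝ) + 1)) :=
    Ioo_mem_nhdsGT hK
  obtain ⟨t, htU, ht0, ht1⟩ := ((hc.eventually hU).and e2).exists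
  have hK0 : (0 : ℝ) ≤ K := K.coe_nonneg
  rw [lt_div_iff₀ (by positivity)] at ht1
  have hlt : t ≤ 1 := by nlinarith
  have hd := hL.dist_le_mul _ htU _ (mem_of_mem_nhds hU)
  have hne : ((t ^ 3, t ^ 2) : ℝ × ℝ) ≠ (0, 0) := by
    intro hcon
    have := congrArg Prod.snd hcon
    simp at this
    exact ht0.ne' this
  have hv : h (t ^ 3, t ^ 2) = t / 2 := by
    rw [hh, if_neg hne]
    have := ht0.ne'
    field_simp
    ring
  have h0 : h (0, 0) = 0 := by rw [hh, if_pos rfl]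
  have hle : dist ((t ^ 3, t ^ 2) : ℝ × ℝ) (0, 0) ≤ t ^ 2 := by
    rw [Prod.dist_eq]
    simp only [Real.dist_eq, sub_zero]
    rw [abs_of_pos (by positivity), abs_of_pos (by positivity)]
    exact max_le (pow_le_pow_of_le_one ht0.le hlt (by norm_num)) le_rfl
  rw [hv, h0, Real.dist_eq, sub_zero, abs_of_pos (by positivity)] at hd
  have := mul_le_mul_of_nonneg_left hle hK0
  nlinarith
end

section
/- Let u : ℝ² → ℝ be a real analytic function. Then the function F : ℝ³ → ℝ defined by F(x,y,z) = z³/(z² + u(x,y)²) when z² + u(x,y)² ≠ 0, and F(x,y,z) = 0 when z = 0 and u(x,y) = 0, is arc-analytic, i.e. for every real analytic curve γ : ℝ → ℝ³, the composition F ∘ γ : ℝ → ℝ is real analytic. -/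
open Filter Topology in
lemma aux_common (a b g h : ℝ → ℝ) (t : ℝ) (k : ℕ) (hg : AnalyticAt ℝ g t) (hh : AnalyticAt ℝ h t)
    (ha : ∀ᶠ s in 𝓝 t, a s = (s - t) ^ k * g s) (hb : ∀ᶠ s in 𝓝 t, b s = (s - t) ^ k * h s)
    (hne : g t ^ 2 + h t ^ 2 ≠ 0) :
    AnalyticAt ℝ (fun s => a s ^ 3 / (a s ^ 2 + b s ^ 2)) t := by
  have h1 : AnalyticAt ℝ (fun s => (s - t) ^ k * (g s ^ 3 / (g s ^ 2 + h s ^ 2))) t := by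
    refine AnalyticAt.mul (by fun_prop) (AnalyticAt.div (by fun_prop) (by fun_prop) hne)
  refine h1.congr ?_
  filter_upwards [ha, hb] with s h2 h3
  rw [h2, h3]
  by_cases hs : (s - t) ^ k = 0
  · simp [hs]
  · generalize (s - t) ^ k = c at hs
    have e : (c * g s) ^ 2 + (c * h s) ^ 2 = c ^ 2 * (g s ^ 2 + h s ^ 2) := by ring
    have e' : (c * g s) ^ 3 = c ^ 2 * (c * g s ^ 3) := by ring
    rw [e, e', mul_div_mul_left _ _ (pow_ne_zero 2 hs), mul_div_assoc]

open Filter Topology in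
lemma aux_main (a b : ℝ → ℝ) (t : ℝ) (ha : AnalyticAt ℝ a t) (hb : AnalyticAt ℝ b t) :
    AnalyticAt ℝ (fun s => a s ^ 3 / (a s ^ 2 + b s ^ 2)) t := by
  by_cases hat : analyticOrderAt a t = ⊤
  · rw [analyticOrderAt_eq_top] at hat
    refine (analyticAt_const (v := (0 : ℝ))).congr ?_
    filter_upwards [hat] with s hs
    simp [hs]
  obtain ⟨m, hm⟩ := ENat.ne_top_iff_exists.mp hat
  rcases le_or_gt (m : ℕ∞) (analyticOrderAt b t) with hle | hlt
  · obtain ⟨g, hg, hg0, hag⟩ := (ha.analyticOrderAt_eq_natCast).mp hm.symm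
    obtain ⟨h, hh, hbh⟩ := (natCast_le_analyticOrderAt hb).mp hle
    exact aux_common a b g h t m hg hh (by simpa using hag) (by simpa using hbh) (by positivity)
  · obtain ⟨n, hn⟩ := ENat.ne_top_iff_exists.mp hlt.ne_top
    have hle : (n : ℕ∞) ≤ analyticOrderAt a t := by rw [hn, ← hm]; exact hlt.le
    obtain ⟨h, hh, hh0, hbh⟩ := (hb.analyticOrderAt_eq_natCast).mp hn.symm
    obtain ⟨g, hg, hag⟩ := (natCast_le_analyticOrderAt ha).mp hle
    exact aux_common a b g h t n hg hh (by simpa using hag) (by simpa using hbh) (by positivity)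


open Classical in
/-- For `u : ℝ² → ℝ` real analytic, the function `F(x,y,z) = z³/(z² + u(x,y)²)`
(equal to `0` when `z² + u(x,y)² = 0`) is arc-analytic: for every real analytic curve
`γ : ℝ → ℝ³`, the composition `F ∘ γ` is real analytic. -/
theorem stmt_6
    (u : ℝ × ℝ → ℝ) (hu : ∀ p : ℝ × ℝ, AnalyticAt ℝ u p)
    (F : ℝ × ℝ × ℝ → ℝ)
    (hF : ∀ p : ℝ × ℝ × ℝ,
      F p = if p.2.2 ^ 2 + u (p.1, p.2.1) ^ 2 = 0 then 0
            else p.2.2 ^ 3 / (p.2.2 ^ 2 + u (p.1, p.2.1) ^ 2))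
    (γ : ℝ → ℝ × ℝ × ℝ) (hγ : ∀ t : ℝ, AnalyticAt ℝ γ t) :
    ∀ t : ℝ, AnalyticAt ℝ (F ∘ γ) t := by

  intro t
  have h1 : AnalyticAt ℝ (fun s => (γ s).1) t := analyticAt_fst.comp (hγ t)
  have h2 : AnalyticAt ℝ (fun s => (γ s).2) t := analyticAt_snd.comp (hγ t)
  have h3 : AnalyticAt ℝ (fun s => (γ s).2.1) t := analyticAt_fst.comp h2
  have h4 : AnalyticAt ℝ (fun s => (γ s).2.2) t := analyticAt_snd.comp h2
  have h5 : AnalyticAt ℝ (fun s => u ((γ s).1, (γ s).2.1)) t :=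
    AnalyticAt.comp (g := u) (f := fun s => ((γ s).1, (γ s).2.1)) (hu _) (h1.prod h3)
  have key := aux_main _ _ t h4 h5
  have e : F ∘ γ = fun s => (γ s).2.2 ^ 3 /
      ((γ s).2.2 ^ 2 + u ((γ s).1, (γ s).2.1) ^ 2) := by
    funext s
    simp only [Function.comp, hF]
    split_ifs with h0
    · rw [h0, div_zero]
    · rfl
  rw [e]
  exact key
end

section
/- Let u : ℝ² → ℝ be a real analytic function and let (x₀,y₀) ∈ ℝ² be a point with u(x₀,y₀) = 0 and with the gradient of u at (x₀,y₀) nonzero. Then the function F : ℝ³ → ℝ defined by F(x,y,z) = z³/(z² + u(x,y)²) when z² + u(x,y)² ≠ 0, and F(x,y,z) = 0 otherwise, is not real analytic at the point (x₀,y₀,0), i.e. the germ of F at (x₀,y₀,0) is not given by a convergent power series. -/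
open Classical in
/-- For `u : ℝ² → ℝ` real analytic with `u(x₀,y₀) = 0` and nonzero gradient at
`(x₀,y₀)`, the function `F(x,y,z) = z³/(z² + u(x,y)²)` (equal to `0` when
`z² + u(x,y)² = 0`) is not real analytic at `(x₀,y₀,0)`. -/
theorem stmt_7
    (u : ℝ × ℝ → ℝ) (hu : ∀ p : ℝ × ℝ, AnalyticAt ℝ u p)
    (x₀ y₀ : ℝ) (hu0 : u (x₀, y₀) = 0) (hgrad : fderiv ℝ u (x₀, y₀) ≠ 0)
    (F : ℝ × ℝ × ℝ → ℝ)
    (hF : ∀ p : ℝ × ℝ × ℝ,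
      F p = if p.2.2 ^ 2 + u (p.1, p.2.1) ^ 2 = 0 then 0
            else p.2.2 ^ 3 / (p.2.2 ^ 2 + u (p.1, p.2.1) ^ 2)) :
    ¬ AnalyticAt ℝ F (x₀, y₀, 0) := by
  intro hA
  have hd := hA.differentiableAt.hasFDerivAt
  set L := fderiv ℝ F (x₀, y₀, 0) with hL
  have hud := (hu (x₀, y₀)).differentiableAt.hasFDerivAt
  obtain ⟨w, hw⟩ : ∃ w, fderiv ℝ u (x₀, y₀) w ≠ 0 := by
    by_contra h
    push Not at h
    exact hgrad (ContinuousLinearMap.ext h)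
  obtain ⟨a, b, hab⟩ : ∃ a b : ℝ, fderiv ℝ u (x₀, y₀) (a, b) = 1 := by
    refine ⟨((fderiv ℝ u (x₀, y₀) w)⁻¹ • w).1, ((fderiv ℝ u (x₀, y₀) w)⁻¹ • w).2, ?_⟩
    rw [Prod.mk.eta, map_smul, smul_eq_mul, inv_mul_cancel₀ hw]
  have hline : ∀ c d : ℝ, HasDerivAt (fun t : ℝ => c + t * d) d 0 := by
    intro c d
    simpa using ((hasDerivAt_id (0 : ℝ)).mul_const d).const_add c
  have hcu : HasDerivAt (fun t : ℝ => u (x₀ + t * a, y₀ + t * b)) 1 0 := by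
    rw [← hab]
    refine HasFDerivAt.comp_hasDerivAt (f := fun t : ℝ => (x₀ + t * a, y₀ + t * b)) 0 ?_
      ((hline x₀ a).prodMk (hline y₀ b))
    simpa using hud
  have hlimu := hasDerivAt_iff_tendsto_slope.1 hcu
  have key : ∀ s : ℝ, s ≠ 0 → L (a, b, s) = s ^ 3 / (s ^ 2 + 1) := by
    intro s hs
    have h1 : HasDerivAt (fun t : ℝ => F (x₀ + t * a, y₀ + t * b, 0 + t * s)) (L (a, b, s)) 0 := by
      refine HasFDerivAt.comp_hasDerivAt
        (f := fun t : ℝ => (x₀ + t * a, y₀ + t * b, 0 + t * s)) 0 ?_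
        ((hline x₀ a).prodMk ((hline y₀ b).prodMk (hline 0 s)))
      simpa using hd
    have h2 := hasDerivAt_iff_tendsto_slope.1 h1
    have h3 : Filter.Tendsto (fun t : ℝ => s ^ 3 /
        (s ^ 2 + (slope (fun t : ℝ => u (x₀ + t * a, y₀ + t * b)) 0 t) ^ 2))
        (nhdsWithin 0 {0}ᶜ) (nhds (s ^ 3 / (s ^ 2 + 1 ^ 2))) := by
      refine Filter.Tendsto.div tendsto_const_nhds (tendsto_const_nhds.add (hlimu.pow 2)) ?_
      positivity
    rw [one_pow] at h3
    refine tendsto_nhds_unique h2 (h3.congr' ?_)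
    filter_upwards [self_mem_nhdsWithin] with t ht
    have ht : t ≠ 0 := ht
    have hne : (t * s) ^ 2 + u (x₀ + t * a, y₀ + t * b) ^ 2 ≠ 0 := by positivity
    have hne2 : s ^ 2 + (u (x₀ + t * a, y₀ + t * b) / t) ^ 2 ≠ 0 := by positivity
    simp only [slope_def_field, hF, zero_add, zero_mul, add_zero, hu0, sub_zero, if_neg hne]
    have h0 : ((0 : ℝ) ^ 2 + 0 ^ 2 = 0) := by norm_num
    rw [if_pos h0, sub_zero]
    have e : (t * s) ^ 2 + u (x₀ + t * a, y₀ + t * b) ^ 2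
        = t ^ 2 * (s ^ 2 + (u (x₀ + t * a, y₀ + t * b) / t) ^ 2) := by
      field_simp
    rw [e]
    generalize s ^ 2 + (u (x₀ + t * a, y₀ + t * b) / t) ^ 2 = q at hne2
    field_simp
  have hlin : ∀ s : ℝ, L (a, b, s) = L (a, b, 0) + s * L (0, 0, 1) := by
    intro s
    rw [← smul_eq_mul, ← map_smul, ← map_add]
    simp
  have k1 := key 1 (by norm_num)
  have k2 := key (-1) (by norm_num)
  have k3 := key 2 (by norm_num)
  rw [hlin] at k1 k2 k3
  norm_num at k1 k2 k3
  linarith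
end

section
/- For every real analytic curve γ = (γ₁,γ₂) : (-1,1) → ℝ² such that γ(t) ≠ (0,0) for all t ≠ 0, there exists a real analytic function φ : (-1,1) → ℝ with φ(t) = γ₁(t)·γ₂(t)/(γ₁(t)² + γ₂(t)²) for every t ≠ 0. -/
/-- For every real analytic curve `γ = (γ₁,γ₂) : (-1,1) → ℝ²` with `γ(t) ≠ (0,0)` for
all `t ≠ 0`, there exists a real analytic function `φ : (-1,1) → ℝ` with
`φ(t) = γ₁(t)·γ₂(t)/(γ₁(t)² + γ₂(t)²)` for every `t ≠ 0`. -/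
theorem stmt_8
    (γ₁ γ₂ : ℝ → ℝ)
    (hγ₁ : ∀ t ∈ Set.Ioo (-1 : ℝ) 1, AnalyticAt ℝ γ₁ t)
    (hγ₂ : ∀ t ∈ Set.Ioo (-1 : ℝ) 1, AnalyticAt ℝ γ₂ t)
    (hne : ∀ t ∈ Set.Ioo (-1 : ℝ) 1, t ≠ 0 → (γ₁ t, γ₂ t) ≠ (0, 0)) :
    ∃ φ : ℝ → ℝ, (∀ t ∈ Set.Ioo (-1 : ℝ) 1, AnalyticAt ℝ φ t) ∧
      ∀ t ∈ Set.Ioo (-1 : ℝ) 1, t ≠ 0 →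
        φ t = γ₁ t * γ₂ t / (γ₁ t ^ 2 + γ₂ t ^ 2) := by
  classical
  have key : ∀ a b : ℝ, (a, b) ≠ (0, 0) → a ^ 2 + b ^ 2 ≠ 0 := by
    intro a b h h0
    apply h
    have ha : a = 0 := by nlinarith [sq_nonneg a, sq_nonneg b]
    have hb : b = 0 := by nlinarith [sq_nonneg a, sq_nonneg b]
    rw [ha, hb]
  have h0 : (0 : ℝ) ∈ Set.Ioo (-1 : ℝ) 1 := by constructor <;> norm_num
  have hf : AnalyticAt ℝ (fun t => (γ₁ t, γ₂ t)) 0 := (hγ₁ 0 h0).prod (hγ₂ 0 h0)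
  have hnz : ¬ ∀ᶠ z in nhds (0 : ℝ), (fun t => (γ₁ t, γ₂ t)) z = 0 := by
    intro h
    have h1 := (h.and (Ioo_mem_nhds h0.1 h0.2)).filter_mono
      (nhdsWithin_le_nhds (s := {(0 : ℝ)}ᶜ))
    obtain ⟨z, ⟨hz, hzI⟩, hz0⟩ := (h1.and self_mem_nhdsWithin).exists
    exact hne z hzI hz0 hz
  obtain ⟨n, g, hg, hg0, hfg⟩ := hf.exists_eventuallyEq_pow_smul_nonzero_iff.mpr hnz
  have hg1 : AnalyticAt ℝ (fun t => (g t).1) 0 := analyticAt_fst.comp hg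
  have hg2 : AnalyticAt ℝ (fun t => (g t).2) 0 := analyticAt_snd.comp hg
  have hgne : (g 0).1 ^ 2 + (g 0).2 ^ 2 ≠ 0 := key _ _ hg0
  let r : ℝ → ℝ := fun t => γ₁ t * γ₂ t / (γ₁ t ^ 2 + γ₂ t ^ 2)
  let q : ℝ → ℝ := fun t => (g t).1 * (g t).2 / ((g t).1 ^ 2 + (g t).2 ^ 2)
  have hq : AnalyticAt ℝ q 0 := (hg1.mul hg2).div ((hg1.pow 2).add (hg2.pow 2)) hgne
  refine ⟨Function.update r 0 (q 0), ?_, ?_⟩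
  · intro t ht
    by_cases ht0 : t = 0
    · subst ht0
      refine hq.congr ?_
      filter_upwards [hfg] with z hz
      by_cases hz0 : z = 0
      · subst hz0; simp
      · rw [Function.update_of_ne hz0]
        have e1 : γ₁ z = z ^ n * (g z).1 := by simpa using congrArg Prod.fst hz
        have e2 : γ₂ z = z ^ n * (g z).2 := by simpa using congrArg Prod.snd hz
        have hp : (z ^ n) ^ 2 ≠ 0 := pow_ne_zero _ (pow_ne_zero _ hz0)
        simp only [q, r, e1, e2]
        rw [← mul_div_mul_left _ _ hp]
        congr 1 <;> ring
    · have hr : AnalyticAt ℝ r t := ((hγ₁ t ht).mul (hγ₂ t ht)).div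
        (((hγ₁ t ht).pow 2).add ((hγ₂ t ht).pow 2)) (key _ _ (hne t ht ht0))
      refine hr.congr ?_
      filter_upwards [isOpen_ne.mem_nhds ht0] with z hz
      rw [Function.update_of_ne hz]
  · intro t _ ht0
    rw [Function.update_of_ne ht0]
end

section
/- Let V ⊆ ℝⁿ be starlike with respect to the origin, let a ∈ ℝⁿ, let L ≥ 0, and let P : ℝⁿ → ℝ be a homogeneous polynomial of degree k. If |P(x)| ≤ L for every x in the translate a + V, then |P(v)| ≤ L for every v in the scaled set (1/(2e))·V = {(1/(2e))·w : w ∈ V}, where e is Euler's number. -/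
open Polynomial in
/-- Restriction of a monomial to a line: degree bound and top coefficient. -/
lemma line_monomial {n : ℕ} (a w : Fin n → ℝ) (d : Fin n →₀ ℕ) (s : Finset (Fin n)) :
    (∏ i ∈ s, (C (a i) + C (w i) * X : ℝ[X]) ^ d i).natDegree ≤ ∑ i ∈ s, d i ∧
    (∏ i ∈ s, (C (a i) + C (w i) * X : ℝ[X]) ^ d i).coeff (∑ i ∈ s, d i) = ∏ i ∈ s, w i ^ d i := by
  induction s using Finset.induction_on with
  | empty => simp
  | insert i s hi ih =>
    have h1 : (C (a i) + C (w i) * X : ℝ[X]).natDegree ≤ 1 := by compute_degree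
    have h2 : ((C (a i) + C (w i) * X : ℝ[X]) ^ d i).natDegree ≤ d i := by
      simpa using natDegree_pow_le_of_le (d i) h1
    have h3 : ((C (a i) + C (w i) * X : ℝ[X]) ^ d i).coeff (d i) = w i ^ d i := by
      have := coeff_pow_of_natDegree_le (m := d i) h1
      simpa [coeff_C] using this
    rw [Finset.prod_insert hi, Finset.sum_insert hi, Finset.prod_insert hi]
    refine ⟨natDegree_mul_le_of_le h2 ih.1, ?_⟩
    rw [coeff_mul_add_eq_of_natDegree_le h2 ih.1, h3, ih.2]

open Polynomial in
/-- Restriction of a homogeneous polynomial to a line. -/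
lemma line_poly {n k : ℕ} (a w : Fin n → ℝ) (P : MvPolynomial (Fin n) ℝ)
    (hP : P.IsHomogeneous k) :
    ∃ q : ℝ[X], q.natDegree ≤ k ∧ q.coeff k = MvPolynomial.eval w P ∧
      ∀ t : ℝ, q.eval t = MvPolynomial.eval (a + t • w) P := by
  refine ⟨∑ d ∈ P.support, C (P.coeff d) * ∏ i, (C (a i) + C (w i) * X : ℝ[X]) ^ d i,
    ?_, ?_, ?_⟩
  · refine natDegree_sum_le_of_forall_le _ _ fun d hd => ?_
    have hk : ∑ i, d i = k := by
      have := hP (MvPolynomial.mem_support_iff.1 hd)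
      rwa [Pi.one_def, ← Finsupp.degree_eq_weight_one, Finsupp.degree_eq_sum] at this
    exact (natDegree_C_mul_le _ _).trans (hk ▸ (line_monomial a w d Finset.univ).1)
  · rw [finsetSum_coeff, MvPolynomial.eval_eq']
    refine Finset.sum_congr rfl fun d hd => ?_
    have hk : ∑ i, d i = k := by
      have := hP (MvPolynomial.mem_support_iff.1 hd)
      rwa [Pi.one_def, ← Finsupp.degree_eq_weight_one, Finsupp.degree_eq_sum] at this
    rw [coeff_C_mul, ← hk, (line_monomial a w d Finset.univ).2]
  · intro t
    rw [MvPolynomial.eval_eq', eval_finsetSum]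
    refine Finset.sum_congr rfl fun d _ => ?_
    simp [eval_prod, mul_comm t]

lemma hom_eval_smul {n k : ℕ} (c : ℝ) (w : Fin n → ℝ) (P : MvPolynomial (Fin n) ℝ)
    (hP : P.IsHomogeneous k) :
    MvPolynomial.eval (c • w) P = c ^ k * MvPolynomial.eval w P := by
  rw [MvPolynomial.eval_eq', MvPolynomial.eval_eq', Finset.mul_sum]
  refine Finset.sum_congr rfl fun d hd => ?_
  have hk : ∑ i, d i = k := by
    have := hP (MvPolynomial.mem_support_iff.1 hd)
    rwa [Pi.one_def, ← Finsupp.degree_eq_weight_one, Finsupp.degree_eq_sum] at this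
  simp only [Pi.smul_apply, smul_eq_mul, mul_pow, Finset.prod_mul_distrib,
    Finset.prod_pow_eq_pow_sum, hk]
  ring

/-- The `k`-th finite difference of a polynomial of degree at most `k`. -/
lemma finite_diff (k : ℕ) (q : Polynomial ℝ) (hq : q.natDegree ≤ k) :
    ∑ j ∈ Finset.range (k + 1), ((-1 : ℝ) ^ (k - j) * (k.choose j : ℝ)) * q.eval (j : ℝ)
      = (k.factorial : ℝ) * q.coeff k := by
  have hpow : ∀ m ≤ k, ∑ j ∈ Finset.range (k + 1),
      ((-1 : ℝ) ^ (k - j) * (k.choose j : ℝ)) * (j : ℝ) ^ m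
      = if m = k then (k.factorial : ℝ) else 0 := by
    intro m hm
    have h := fwdDiff_iter_eq_sum_shift (1 : ℝ) (fun r : ℝ => r ^ m) k 0
    have h' : ∑ j ∈ Finset.range (k + 1),
      ((-1 : ℝ) ^ (k - j) * (k.choose j : ℝ)) * (j : ℝ) ^ m =
        (fwdDiff (1 : ℝ))^[k] (fun r : ℝ => r ^ m) 0 := by
      rw [h]
      refine Finset.sum_congr rfl fun j _ => ?_
      simp
    rw [h']
    split_ifs with hmk
    · subst hmk
      rw [fwdDiff_iter_eq_factorial]; simp
    · rw [fwdDiff_iter_pow_eq_zero_of_lt (lt_of_le_of_ne hm hmk)]; simp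
  have he : ∀ x : ℝ, q.eval x = ∑ m ∈ Finset.range (k + 1), q.coeff m * x ^ m := fun x =>
    Polynomial.eval_eq_sum_range' (Nat.lt_succ_of_le hq) x
  simp_rw [he, Finset.mul_sum]
  rw [Finset.sum_comm]
  have : ∀ m ∈ Finset.range (k + 1), ∑ j ∈ Finset.range (k + 1),
      ((-1 : ℝ) ^ (k - j) * (k.choose j : ℝ)) * (q.coeff m * (j : ℝ) ^ m)
      = q.coeff m * (if m = k then (k.factorial : ℝ) else 0) := by
    intro m hm
    rw [← hpow m (Nat.lt_succ_iff.1 (Finset.mem_range.1 hm)), Finset.mul_sum]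
    exact Finset.sum_congr rfl fun j _ => by ring
  rw [Finset.sum_congr rfl this]
  simp [mul_comm]

/-- If `V ⊆ ℝⁿ` is starlike with respect to the origin, `P` is a homogeneous polynomial
of degree `k`, and `|P| ≤ L` on the translate `a + V`, then `|P| ≤ L` on `(1/(2e))·V`. -/
theorem stmt_12
    (n k : ℕ) (V : Set (Fin n → ℝ))
    (hV : ∀ v ∈ V, ∀ t : ℝ, t ∈ Set.Icc (0 : ℝ) 1 → t • v ∈ V)
    (a : Fin n → ℝ) (L : ℝ) (hL : 0 ≤ L)
    (P : MvPolynomial (Fin n) ℝ) (hP : P.IsHomogeneous k)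
    (hbound : ∀ x ∈ V, |MvPolynomial.eval (a + x) P| ≤ L) :
    ∀ w ∈ V, |MvPolynomial.eval ((1 / (2 * Real.exp 1)) • w) P| ≤ L := by
  intro w hw
  obtain ⟨q, hq1, hq2, hq3⟩ := line_poly a ((1 / (k : ℝ)) • w) P hP
  have hfd := finite_diff k q hq1
  have hqb : ∀ j ∈ Finset.range (k + 1), |q.eval (j : ℝ)| ≤ L := by
    intro j hj
    have hjk : (j : ℝ) ≤ k := by exact_mod_cast Nat.lt_succ_iff.1 (Finset.mem_range.1 hj)
    rw [hq3, smul_smul]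
    refine hbound _ (hV w hw _ ⟨by positivity, ?_⟩)
    rw [mul_one_div]
    exact div_le_one_of_le₀ hjk (by positivity)
  have hsum : |(k.factorial : ℝ) * q.coeff k| ≤ 2 ^ k * L := by
    rw [← hfd]
    refine (Finset.abs_sum_le_sum_abs _ _).trans ?_
    have h2 : (2 : ℝ) ^ k * L = ∑ j ∈ Finset.range (k + 1), (k.choose j : ℝ) * L := by
      rw [← Finset.sum_mul]
      congr 1
      exact_mod_cast (Nat.sum_range_choose k).symm
    rw [h2]
    refine Finset.sum_le_sum fun j hj => ?_
    rw [abs_mul, abs_mul, abs_pow, abs_neg, abs_one, one_pow, one_mul, Nat.abs_cast]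
    exact mul_le_mul_of_nonneg_left (hqb j hj) (by positivity)
  rw [hq2, hom_eval_smul _ _ _ hP] at hsum
  rw [hom_eval_smul _ _ _ hP]
  have hexp : (k : ℝ) ^ k / k.factorial ≤ Real.exp 1 ^ k := by
    rw [← Real.exp_nat_mul, mul_one]
    exact Real.pow_div_factorial_le_exp _ (by positivity) k
  have hf : (0 : ℝ) < k.factorial := by exact_mod_cast k.factorial_pos
  have hkk : (0 : ℝ) < (k : ℝ) ^ k := by
    rcases Nat.eq_zero_or_pos k with h | h
    · subst h; simp
    · have : (0 : ℝ) < k := by exact_mod_cast h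
      positivity
  have hE : (0 : ℝ) < Real.exp 1 ^ k := by positivity
  rw [abs_mul, abs_mul, abs_of_pos hf, abs_of_pos (by rw [one_div, inv_pow]; positivity),
    one_div, inv_pow] at hsum
  rw [abs_mul, abs_of_pos (by positivity), one_div, inv_pow, mul_pow,
    inv_mul_le_iff₀ (by positivity)]
  set A := |MvPolynomial.eval w P|
  have h1 : A ≤ (k : ℝ) ^ k / k.factorial * (2 ^ k * L) := by
    calc A = (k : ℝ) ^ k / k.factorial * (k.factorial * (((k : ℝ) ^ k)⁻¹ * A)) := by
          field_simp
      _ ≤ _ := by gcongr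
  calc A ≤ (k : ℝ) ^ k / k.factorial * (2 ^ k * L) := h1
    _ ≤ Real.exp 1 ^ k * (2 ^ k * L) := by gcongr
    _ = _ := by ring
end

section
/- Let I ⊆ ℝ be an open interval, let D ⊆ I be a set with no accumulation point in I, and let g : I → ℝ be a continuous function which is real analytic on I \ D. Suppose that for every d ∈ D there exist m ∈ ℕ, an ε > 0, and a real analytic function φ on (d−ε, d+ε) such that g(t) = φ(t)/(t−d)^m for all t ∈ (d−ε, d+ε) with t ≠ d. Then g is real analytic on all of I. -/
/-- Let `I ⊆ ℝ` be an open interval, `D ⊆ I` a set with no accumulation point in `I`,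
and `g : I → ℝ` continuous on `I` and real analytic on `I \ D`. If for every `d ∈ D`
there are `m ∈ ℕ`, `ε > 0` and a real analytic `φ` on `(d−ε, d+ε)` with
`g(t) = φ(t)/(t−d)^m` for `t ≠ d` in that interval, then `g` is real analytic on `I`. -/
theorem stmt_14
    (I : Set ℝ) (hIopen : IsOpen I) (hIinterval : I.OrdConnected)
    (D : Set ℝ) (hDI : D ⊆ I)
    (hDacc : ∀ x ∈ I, ∃ U ∈ nhds x, (D ∩ U).Finite)
    (g : ℝ → ℝ) (hgcont : ContinuousOn g I)
    (hganal : ∀ t ∈ I \ D, AnalyticAt ℝ g t)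
    (hD : ∀ d ∈ D, ∃ (m : ℕ) (ε : ℝ) (φ : ℝ → ℝ), 0 < ε ∧
      (∀ t ∈ Set.Ioo (d - ε) (d + ε), AnalyticAt ℝ φ t) ∧
      ∀ t ∈ Set.Ioo (d - ε) (d + ε), t ≠ d → g t = φ t / (t - d) ^ m) :
    ∀ t ∈ I, AnalyticAt ℝ g t := by
  intro t ht
  by_cases htD : t ∈ D
  · obtain ⟨m, ε, φ, hε, hφ, hg⟩ := hD t htD
    have hmem : t ∈ Set.Ioo (t - ε) (t + ε) := ⟨by linarith, by linarith⟩
    have hφm : MeromorphicAt φ t := (hφ t hmem).meromorphicAt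
    have hpow : MeromorphicAt (fun s : ℝ => (s - t) ^ m) t := by
      have : AnalyticAt ℝ (fun s : ℝ => (s - t) ^ m) t := by fun_prop
      exact this.meromorphicAt
    have hquot := hφm.div hpow
    have hmer : MeromorphicAt g t := by
      refine hquot.congr ?_
      have h1 : ∀ᶠ s in nhdsWithin t {t}ᶜ, s ∈ Set.Ioo (t - ε) (t + ε) :=
        mem_nhdsWithin_of_mem_nhds (isOpen_Ioo.mem_nhds hmem)
      filter_upwards [h1, self_mem_nhdsWithin] with s hs hne
      exact (hg s hs hne).symm
    exact hmer.analyticAt (hgcont.continuousAt (hIopen.mem_nhds ht))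
  · exact hganal t ⟨ht, htD⟩
end

section
/- There exists ε₀ > 0 such that for every ε with 0 < ε ≤ ε₀ and every (x,y) ∈ ℝ², one has (x − 3/2)² + ε·(y² + x(x−1)(x−2)(x−3)) > 0. -/
/-- There exists `ε₀ > 0` such that for all `0 < ε ≤ ε₀` and all `(x,y) ∈ ℝ²`,
`(x − 3/2)² + ε·(y² + x(x−1)(x−2)(x−3)) > 0`. -/
theorem stmt_16 :
    ∃ ε₀ : ℝ, 0 < ε₀ ∧ ∀ ε : ℝ, 0 < ε → ε ≤ ε₀ → ∀ x y : ℝ,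
      0 < (x - 3 / 2) ^ 2 + ε * (y ^ 2 + x * (x - 1) * (x - 2) * (x - 3)) := by
  refine ⟨1 / 10, by norm_num, fun ε h0 h1 x y => ?_⟩
  have key : (x - 3 / 2) ^ 2 + ε * (y ^ 2 + x * (x - 1) * (x - 2) * (x - 3))
      = (x - 3 / 2) ^ 2 * (1 - 5 / 2 * ε) + ε * (y ^ 2 + ((x - 3 / 2) ^ 2) ^ 2 + 9 / 16) := by
    ring
  rw [key]
  have h2 : 0 ≤ 1 - 5 / 2 * ε := by linarith
  have h3 : 0 ≤ (x - 3 / 2) ^ 2 * (1 - 5 / 2 * ε) := mul_nonneg (sq_nonneg _) h2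
  have h4 : 0 < ε * (y ^ 2 + ((x - 3 / 2) ^ 2) ^ 2 + 9 / 16) := by positivity
  linarith
end

section
/- Let g(x,y) = y² + x(x−1)(x−2)(x−3), h(x,y) = x − 3/2, and let ε > 0 be such that h(x,y)² + ε·g(x,y) > 0 for all (x,y) ∈ ℝ². Define g₁(x,y) = √(h(x,y)² + ε·g(x,y)) + h(x,y). Then g₁ is real analytic on ℝ², the zero set of g₁ equals Z ∩ {x < 3/2} where Z = {(x,y) : g(x,y) = 0}, and the gradient of g₁ is nonzero at every point of the zero set of g₁ (i.e. 0 is a regular value of g₁). -/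
/-- With `g(x,y) = y² + x(x−1)(x−2)(x−3)`, `h(x,y) = x − 3/2`, and `ε > 0` such that
`h² + ε·g > 0` everywhere, the function `g₁ = √(h² + ε·g) + h` is real analytic on `ℝ²`,
its zero set is `Z ∩ {x < 3/2}` where `Z = {g = 0}`, and `0` is a regular value of `g₁`
(its gradient is nonzero at every zero of `g₁`). -/
theorem stmt_17
    (g h g₁ : ℝ × ℝ → ℝ) (ε : ℝ) (hε : 0 < ε)
    (hg : ∀ p : ℝ × ℝ, g p = p.2 ^ 2 + p.1 * (p.1 - 1) * (p.1 - 2) * (p.1 - 3))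
    (hh : ∀ p : ℝ × ℝ, h p = p.1 - 3 / 2)
    (hpos : ∀ p : ℝ × ℝ, 0 < h p ^ 2 + ε * g p)
    (hg₁ : ∀ p : ℝ × ℝ, g₁ p = Real.sqrt (h p ^ 2 + ε * g p) + h p) :
    (∀ p : ℝ × ℝ, AnalyticAt ℝ g₁ p) ∧
    {p : ℝ × ℝ | g₁ p = 0} = {p : ℝ × ℝ | g p = 0} ∩ {p : ℝ × ℝ | p.1 < 3 / 2} ∧
    (∀ p : ℝ × ℝ, g₁ p = 0 → fderiv ℝ g₁ p ≠ 0) := by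
  have hfun : g₁ = fun p => Real.sqrt (h p ^ 2 + ε * g p) + h p := funext hg₁
  have hgf : g = fun p => p.2 ^ 2 + p.1 * (p.1 - 1) * (p.1 - 2) * (p.1 - 3) := funext hg
  have hhf : h = fun p => p.1 - 3 / 2 := funext hh
  have hgc : ContDiff ℝ ⊤ g := by rw [hgf]; fun_prop
  have hhc : ContDiff ℝ ⊤ h := by rw [hhf]; fun_prop
  have han : ∀ p : ℝ × ℝ, AnalyticAt ℝ g₁ p := by
    intro p
    refine ContDiffAt.analyticAt ?_
    rw [hfun]
    refine ContDiffAt.add (ContDiffAt.sqrt ?_ (hpos p).ne') hhc.contDiffAt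
    exact ((hhc.pow 2).add (contDiff_const.mul hgc)).contDiffAt
  have hzero : ∀ p : ℝ × ℝ, g₁ p = 0 ↔ g p = 0 ∧ p.1 < 3 / 2 := by
    intro p
    have hs := Real.sqrt_pos.2 (hpos p)
    have hq := Real.sq_sqrt (hpos p).le
    have h1 := hg₁ p
    have h2 := hh p
    constructor
    · intro h0
      have e : Real.sqrt (h p ^ 2 + ε * g p) = - h p := by linarith
      rw [e] at hq hs
      have : ε * g p = 0 := by linarith [neg_sq (h p)]
      exact ⟨(mul_eq_zero.1 this).resolve_left hε.ne', by linarith⟩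
    · rintro ⟨h0, hx⟩
      rw [h1, h0, mul_zero, add_zero, Real.sqrt_sq_eq_abs, abs_of_neg (by linarith)]
      ring
  refine ⟨han, Set.ext fun p => hzero p, ?_⟩
  intro p h0 hd
  have hG : HasFDerivAt g₁ (0 : ℝ × ℝ →L[ℝ] ℝ) p := by
    rw [← hd]; exact (han p).differentiableAt.hasFDerivAt
  have hH : HasFDerivAt h (fderiv ℝ h p) p :=
    (hhc.differentiable (by simp) p).hasFDerivAt
  have hE : HasFDerivAt (fun q => ε * g q) (0 : ℝ × ℝ →L[ℝ] ℝ) p := by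
    have hM := hG.mul (hG.sub (hH.const_mul 2))
    have e : (fun q => ε * g q) = g₁ * (g₁ - fun q => 2 * h q) := by
      funext q
      have hq := Real.sq_sqrt (hpos q).le
      simp only [Pi.mul_apply, Pi.sub_apply, hg₁ q]
      linear_combination -hq
    rw [e]
    refine hM.congr_fderiv ?_
    simp [h0]
  have hgz := (hzero p).1 h0 |>.1
  obtain ⟨x, y⟩ := p
  have hy : HasDerivAt (fun t : ℝ => ε * g (x, t)) 0 y := by
    have := HasFDerivAt.comp_hasDerivAt y hE ((hasDerivAt_const y x).prodMk (hasDerivAt_id y))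
    simpa [Function.comp_def] using this
  have hx : HasDerivAt (fun t : ℝ => ε * g (t, y)) 0 x := by
    have := HasFDerivAt.comp_hasDerivAt x hE ((hasDerivAt_id x).prodMk (hasDerivAt_const x y))
    simpa [Function.comp_def] using this
  simp only [hg] at hx hy hgz
  have hy2 := ((((hasDerivAt_id y).pow 2).add_const (x * (x - 1) * (x - 2) * (x - 3))).const_mul ε)
  have hx2 := ((((((hasDerivAt_id x).mul ((hasDerivAt_id x).sub_const 1)).mul
    ((hasDerivAt_id x).sub_const 2)).mul ((hasDerivAt_id x).sub_const 3)).const_add (y ^ 2)).const_mul ε)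
  have ey := hy.unique hy2
  have ex := hx.unique hx2
  simp [hε.ne'] at ey ex
  subst ey
  have hr : x * (x - 1) * (x - 2) * (x - 3) = 0 := by linarith
  simp only [mul_eq_zero] at hr
  rcases hr with ((hr | hr) | hr) | hr
  · subst hr; norm_num at ex
  · obtain rfl : x = 1 := by linarith
    norm_num at ex
  · obtain rfl : x = 2 := by linarith
    norm_num at ex
  · obtain rfl : x = 3 := by linarith
    norm_num at ex
end

section
/- Let n ≥ 2 and 2 ≤ c ≤ n, let Y = {x ∈ ℝⁿ : x₁ = ⋯ = x_c = 0}, and let d²(x) = x₁² + ⋯ + x_c² (the squared Euclidean distance to Y). Let f : ℝⁿ → ℝ be a real analytic function vanishing on Y. Then the function F : ℝⁿ → ℝ defined by F(x) = f(x)³/d²(x) for x ∉ Y and F(x) = 0 for x ∈ Y is arc-analytic, i.e. for every real analytic map γ : ℝ → ℝⁿ, the composition F ∘ γ : ℝ → ℝ is real analytic. -/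
open Classical in
/-- For `Y = {x ∈ ℝⁿ : x₁ = ⋯ = x_c = 0}` of codimension `c ≥ 2`,
`d²(x) = x₁² + ⋯ + x_c²` the squared distance to `Y`, and `f : ℝⁿ → ℝ` real analytic
and vanishing on `Y`, the function `F = f³/d²` (with `F = 0` on `Y`) is arc-analytic:
for every real analytic map `γ : ℝ → ℝⁿ`, `F ∘ γ` is real analytic. -/
theorem stmt_18
    (n c : ℕ) (hn : 2 ≤ n) (hc2 : 2 ≤ c) (hcn : c ≤ n)
    (Y : Set (EuclideanSpace ℝ (Fin n)))
    (hY : Y = {x : EuclideanSpace ℝ (Fin n) | ∀ i : Fin n, (i : ℕ) < c → x i = 0})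
    (d2 : EuclideanSpace ℝ (Fin n) → ℝ)
    (hd2 : ∀ x : EuclideanSpace ℝ (Fin n),
      d2 x = ∑ i ∈ Finset.univ.filter (fun i : Fin n => (i : ℕ) < c), x i ^ 2)
    (f : EuclideanSpace ℝ (Fin n) → ℝ)
    (hf : ∀ x, AnalyticAt ℝ f x) (hfY : ∀ x ∈ Y, f x = 0)
    (F : EuclideanSpace ℝ (Fin n) → ℝ)
    (hF : ∀ x, F x = if x ∈ Y then 0 else f x ^ 3 / d2 x)
    (γ : ℝ → EuclideanSpace ℝ (Fin n)) (hγ : ∀ t : ℝ, AnalyticAt ℝ γ t) :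
    ∀ t : ℝ, AnalyticAt ℝ (F ∘ γ) t := by
  have hg : ∀ t, AnalyticAt ℝ (fun t => f (γ t)) t := fun t => (hf (γ t)).comp (hγ t)
  have hcoord : ∀ t (i : Fin n), AnalyticAt ℝ (fun t => γ t i) t := fun t i =>
    ((EuclideanSpace.proj i : EuclideanSpace ℝ (Fin n) →L[ℝ] ℝ).analyticAt (γ t)).comp (hγ t)
  have hD : ∀ t, AnalyticAt ℝ (fun t => d2 (γ t)) t := by
    intro t
    simp only [hd2]
    exact Finset.analyticAt_fun_sum _ (fun i _ => (hcoord t i).pow 2)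
  have hd0 : ∀ x ∈ Y, d2 x = 0 := by
    intro x hx
    rw [hY] at hx
    rw [hd2]
    refine Finset.sum_eq_zero fun i hi => ?_
    rw [hx i (by simpa using hi)]; norm_num
  have hd1 : ∀ x, d2 x = 0 → x ∈ Y := by
    intro x hx
    rw [hd2, Finset.sum_eq_zero_iff_of_nonneg (fun i _ => sq_nonneg _)] at hx
    rw [hY]
    intro i hi
    exact pow_eq_zero_iff (two_ne_zero) |>.1 (hx i (by simpa using hi))
  have hFeq : F ∘ γ = fun t => f (γ t) ^ 3 / d2 (γ t) := by
    funext t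
    simp only [Function.comp, hF]
    split_ifs with h
    · rw [hd0 _ h, div_zero]
    · rfl
  intro t
  rw [hFeq]
  by_cases ht : d2 (γ t) = 0
  swap
  · exact ((hg t).pow 3).div (hD t) ht
  have htY := hd1 _ ht
  have hmer : MeromorphicAt (fun t => f (γ t) ^ 3 / d2 (γ t)) t :=
    ((hg t).pow 3).meromorphicAt.div (hD t).meromorphicAt
  refine hmer.analyticAt ?_
  -- the projection onto `Y`
  let P : EuclideanSpace ℝ (Fin n) → EuclideanSpace ℝ (Fin n) :=
    fun x => WithLp.toLp 2 (fun i => if (i : ℕ) < c then 0 else x i)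
  have hPY : ∀ x, P x ∈ Y := by
    intro x; rw [hY]; intro i hi; simp [P, hi]
  have hPc : Continuous P := by
    refine (PiLp.continuous_toLp 2 _).comp (continuous_pi fun i => ?_)
    split_ifs
    · exact continuous_const
    · fun_prop
  have hPt : P (γ t) = γ t := by
    rw [hY] at htY
    ext i
    by_cases h : (i : ℕ) < c
    · simp [P, h, htY i h]
    · simp [P, h]
  have hPd : ∀ x, ‖x - P x‖ ^ 2 = d2 x := by
    intro x
    rw [EuclideanSpace.norm_sq_eq, hd2, Finset.sum_filter]
    refine Finset.sum_congr rfl fun i _ => ?_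
    by_cases h : (i : ℕ) < c
    · simp [P, h]
    · simp [P, h]
  obtain ⟨K, s, hs, hK⟩ := ((hf (γ t)).contDiffAt (n := 1)).exists_lipschitzOnWith
  have h1 : ∀ᶠ u in nhds t, γ u ∈ s := (hγ t).continuousAt hs
  have h2 : ∀ᶠ u in nhds t, P (γ u) ∈ s := by
    have : ContinuousAt (fun u => P (γ u)) t := hPc.continuousAt.comp (hγ t).continuousAt
    apply this
    simpa only [hPt] using hs
  have hb : ∀ᶠ u in nhds t, ‖f (γ u) ^ 3 / d2 (γ u)‖ ≤ (K : ℝ) ^ 2 * |f (γ u)| := by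
    filter_upwards [h1, h2] with u hu1 hu2
    have h := hK.norm_sub_le hu1 hu2
    rw [hfY _ (hPY _), sub_zero, Real.norm_eq_abs] at h
    have hsq : |f (γ u)| ^ 2 ≤ (K : ℝ) ^ 2 * d2 (γ u) := by
      rw [← hPd, ← mul_pow]
      exact pow_le_pow_left₀ (abs_nonneg _) h 2
    have hdn : 0 ≤ d2 (γ u) := by rw [← hPd]; positivity
    rw [norm_div, norm_pow, Real.norm_eq_abs, Real.norm_eq_abs, abs_of_nonneg hdn]
    refine div_le_of_le_mul₀ hdn (by positivity) ?_
    nlinarith [mul_le_mul_of_nonneg_right hsq (abs_nonneg (f (γ u)))]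
  have hlim : Filter.Tendsto (fun u => (K : ℝ) ^ 2 * |f (γ u)|) (nhds t) (nhds 0) := by
    have : ContinuousAt (fun u => (K : ℝ) ^ 2 * |f (γ u)|) t :=
      continuousAt_const.mul (hg t).continuousAt.abs
    simpa [ContinuousAt, hfY _ htY] using this
  have := squeeze_zero_norm' hb hlim
  simpa [ContinuousAt, ht] using this
end

section
/- Let n ≥ 2 and 2 ≤ c ≤ n, let Y = {x ∈ ℝⁿ : x₁ = ⋯ = x_c = 0} and d²(x) = x₁² + ⋯ + x_c². Let f : ℝⁿ → ℝ be real analytic and vanish on Y, and let p ∈ Y be a point such that the germ of f at p is not divisible by the germ of d² at p (i.e. there is no real analytic function a on a neighborhood of p with f = a·d² near p). Then the function F : ℝⁿ → ℝ defined by F(x) = f(x)³/d²(x) for x ∉ Y and F(x) = 0 for x ∈ Y is not real analytic at p. -/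
/-- `g` is on the ball of radius `r` the sum of a power series with weighted norm at most `K`. -/
def NB {E : Type*} [NormedAddCommGroup E] [NormedSpace ℝ E] (r K : ℝ) (g : E → ℝ) : Prop :=
  ∃ p : FormalMultilinearSeries ℝ E ℝ, (Summable fun m => ‖p m‖ * r ^ m) ∧
    (∑' m, ‖p m‖ * r ^ m) ≤ K ∧ ∀ y : E, ‖y‖ < r → HasSum (fun m => p m (fun _ => y)) (g y)

section NBsec
variable {E : Type*} [NormedAddCommGroup E] [NormedSpace ℝ E]

lemma NB.mono {r K K' : ℝ} {g : E → ℝ} (h : NB r K g) (hK : K ≤ K') : NB r K' g := by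
  obtain ⟨p, h1, h2, h3⟩ := h
  exact ⟨p, h1, h2.trans hK, h3⟩

lemma NB.zero {r : ℝ} : NB r 0 (fun _ : E => (0 : ℝ)) := by
  refine ⟨0, ?_, ?_, ?_⟩
  · simp
  · simp
  · intro y _
    simp

lemma NB.const {r : ℝ} (M : ContinuousMultilinearMap ℝ (fun _ : Fin 0 => E) ℝ) :
    NB r ‖M‖ (fun y : E => M (fun _ => y)) := by
  let p : FormalMultilinearSeries ℝ E ℝ := fun m => match m with
    | 0 => M
    | _ + 1 => 0
  have hs : HasSum (fun m => ‖p m‖ * r ^ m) (‖M‖) := by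
    have := hasSum_single (f := fun m => ‖p m‖ * r ^ m) 0 (by
      intro m hm
      cases m with
      | zero => exact absurd rfl hm
      | succ m => simp [p])
    simpa [p] using this
  refine ⟨p, hs.summable, hs.tsum_eq.le, ?_⟩
  intro y _
  have := hasSum_single (f := fun m => p m (fun _ => y)) 0 (by
      intro m hm
      cases m with
      | zero => exact absurd rfl hm
      | succ m => simp [p])
  simpa [p] using this

lemma NB.add {r K K' : ℝ} {g g' : E → ℝ} (hr : 0 < r) (h : NB r K g) (h' : NB r K' g') :
    NB r (K + K') (fun y => g y + g' y) := by
  obtain ⟨p, h1, h2, h3⟩ := h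
  obtain ⟨p', h1', h2', h3'⟩ := h'
  have hle : ∀ m, ‖p m + p' m‖ * r ^ m ≤ ‖p m‖ * r ^ m + ‖p' m‖ * r ^ m := by
    intro m
    rw [← add_mul]
    exact mul_le_mul_of_nonneg_right (norm_add_le _ _) (by positivity)
  have hs : Summable fun m => ‖p m + p' m‖ * r ^ m :=
    Summable.of_nonneg_of_le (fun m => by positivity) hle (h1.add h1')
  refine ⟨fun m => p m + p' m, hs, ?_, ?_⟩
  · calc _ ≤ ∑' m, (‖p m‖ * r ^ m + ‖p' m‖ * r ^ m) := hs.tsum_le_tsum hle (h1.add h1')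
      _ = _ := h1.tsum_add h1'
      _ ≤ _ := add_le_add h2 h2'
  · intro y hy
    simpa using (h3 y hy).add (h3' y hy)

lemma NB.neg {r K : ℝ} {g : E → ℝ} (h : NB r K g) : NB r K (fun y => - g y) := by
  obtain ⟨p, h1, h2, h3⟩ := h
  refine ⟨fun m => - p m, by simpa using h1, by simpa using h2, ?_⟩
  intro y hy
  simpa using (h3 y hy).neg

lemma NB.sum {ι : Type*} (s : Finset ι) {r : ℝ} {K : ι → ℝ} {g : ι → E → ℝ} (hr : 0 < r)
    (h : ∀ i ∈ s, NB r (K i) (g i)) : NB r (∑ i ∈ s, K i) (fun y => ∑ i ∈ s, g i y) := by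
  classical
  induction s using Finset.induction_on with
  | empty => simpa using NB.zero
  | insert a s ha ih =>
    simp only [Finset.sum_insert ha]
    exact NB.add hr (h a (Finset.mem_insert_self _ _))
      (ih fun i hi => h i (Finset.mem_insert_of_mem hi))

lemma NB.abs_le {r K : ℝ} {g : E → ℝ} (h : NB r K g) {y : E} (hy : ‖y‖ < r) :
    |g y| ≤ K := by
  obtain ⟨p, h1, h2, h3⟩ := h
  have hle : ∀ m, ‖p m (fun _ => y)‖ ≤ ‖p m‖ * r ^ m := by
    intro m
    refine ((p m).le_opNorm _).trans ?_
    simp only [Finset.prod_const, Finset.card_univ, Fintype.card_fin]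
    gcongr
  rw [← (h3 y hy).tsum_eq, ← Real.norm_eq_abs]
  exact (tsum_of_norm_bounded h1.hasSum hle).trans h2

lemma exists_mulLeft (L : E →L[ℝ] ℝ) (hL : ‖L‖ ≤ 1) (m : ℕ)
    (M : ContinuousMultilinearMap ℝ (fun _ : Fin m => E) ℝ) :
    ∃ M' : ContinuousMultilinearMap ℝ (fun _ : Fin (m + 1) => E) ℝ, ‖M'‖ ≤ ‖M‖ ∧
      ∀ y : E, M' (fun _ => y) = L y * M (fun _ => y) := by
  refine ⟨ContinuousLinearMap.uncurryLeft (Ei := fun _ => E) (L.smulRight M), ?_, ?_⟩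
  · rw [ContinuousLinearMap.uncurryLeft_norm, ContinuousLinearMap.norm_smulRight_apply]
    exact mul_le_of_le_one_left (norm_nonneg _) hL
  · intro y
    rw [ContinuousLinearMap.uncurryLeft_apply]
    rfl

lemma NB.coord_mul {r K : ℝ} {g : E → ℝ} (hr : 0 < r) (L : E →L[ℝ] ℝ) (hL : ‖L‖ ≤ 1)
    (h : NB r K g) : NB r (r * K) (fun y => L y * g y) := by
  obtain ⟨p, h1, h2, h3⟩ := h
  choose P hP1 hP2 using fun m => exists_mulLeft L hL m (p m)
  let p' : FormalMultilinearSeries ℝ E ℝ := fun m => match m with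
    | 0 => 0
    | m + 1 => P m
  have hle : ∀ m, ‖p' (m + 1)‖ * r ^ (m + 1) ≤ r * (‖p m‖ * r ^ m) := by
    intro m
    have : ‖p' (m + 1)‖ ≤ ‖p m‖ := hP1 m
    calc _ ≤ ‖p m‖ * r ^ (m + 1) := by gcongr
      _ = _ := by ring
  have hs1 : Summable fun m => ‖p' (m + 1)‖ * r ^ (m + 1) :=
    Summable.of_nonneg_of_le (fun m => by positivity) hle (h1.mul_left r)
  have hs : Summable fun m => ‖p' m‖ * r ^ m := (summable_nat_add_iff 1).1 hs1
  refine ⟨p', hs, ?_, ?_⟩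
  · rw [hs.tsum_eq_zero_add]
    have h0 : p' 0 = 0 := rfl
    rw [h0, norm_zero, zero_mul, zero_add]
    calc _ ≤ ∑' m, r * (‖p m‖ * r ^ m) := hs1.tsum_le_tsum hle (h1.mul_left r)
      _ = r * ∑' m, (‖p m‖ * r ^ m) := tsum_mul_left
      _ ≤ _ := by gcongr
  · intro y hy
    have := ((h3 y hy).mul_left (L y))
    have h4 : HasSum (fun m => p' (m + 1) (fun _ => y)) (L y * g y) := by
      have e : (fun m => p' (m + 1) (fun _ => y)) = fun m => L y * p m (fun _ => y) :=
        funext fun m => hP2 m y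
      rw [e]
      exact this
    have h5 := HasSum.zero_add (f := fun m => p' m (fun _ => y)) h4
    have h0 : p' 0 = 0 := rfl
    simpa [h0] using h5

lemma NB.tsum {r : ℝ} {K : ℕ → ℝ} {g : ℕ → E → ℝ} (hr : 0 < r)
    (hN : ∀ i, NB r (K i) (g i)) (hK : Summable K) :
    NB r (∑' i, K i) (fun y => ∑' i, g i y) := by
  unfold NB at hN
  choose p hp using hN
  have h1 := fun i => (hp i).1
  have h2 := fun i => (hp i).2.1
  have h3 := fun i => (hp i).2.2
  have hS : Summable (fun x : ℕ × ℕ => ‖p x.1 x.2‖ * r ^ x.2) := by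
    rw [summable_prod_of_nonneg (fun x => by positivity)]
    refine ⟨fun i => h1 i, ?_⟩
    exact Summable.of_nonneg_of_le (fun i => tsum_nonneg fun m => by positivity) h2 hK
  have hS' : Summable (fun x : ℕ × ℕ => ‖p x.2 x.1‖ * r ^ x.1) :=
    (Equiv.prodComm ℕ ℕ).summable_iff.2 hS
  have hS2 := (summable_prod_of_nonneg (fun x => by positivity)).1 hS'
  have hn : ∀ m, Summable (fun i => ‖p i m‖) := by
    intro m
    have := (hS2.1 m).mul_right ((r ^ m)⁻¹)
    refine this.congr ?_
    intro i
    have : r ^ m ≠ 0 := by positivity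
    field_simp
  have hsum : ∀ m, Summable (fun i => p i m) := fun m => (hn m).of_norm
  have hle : ∀ m, ‖∑' i, p i m‖ * r ^ m ≤ ∑' i, ‖p i m‖ * r ^ m := by
    intro m
    rw [tsum_mul_right]
    exact mul_le_mul_of_nonneg_right (norm_tsum_le_tsum_norm (hn m)) (by positivity)
  have hs : Summable (fun m => ‖∑' i, p i m‖ * r ^ m) :=
    Summable.of_nonneg_of_le (fun m => by positivity) hle hS2.2
  refine ⟨fun m => ∑' i, p i m, hs, ?_, ?_⟩
  · calc _ ≤ ∑' m, ∑' i, ‖p i m‖ * r ^ m := hs.tsum_le_tsum hle hS2.2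
      _ = ∑' i, ∑' m, ‖p i m‖ * r ^ m :=
        Summable.tsum_comm (f := fun i m => ‖p i m‖ * r ^ m) hS
      _ ≤ _ := Summable.tsum_le_tsum h2
        (Summable.of_nonneg_of_le (fun i => tsum_nonneg fun m => by positivity) h2 hK) hK
  · intro y hy
    have hT : Summable (fun x : ℕ × ℕ => p x.1 x.2 (fun _ => y)) := by
      refine Summable.of_norm_bounded hS ?_
      rintro ⟨i, m⟩
      refine ((p i m).le_opNorm _).trans ?_
      simp only [Finset.prod_const, Finset.card_univ, Fintype.card_fin]
      gcongr
    have e1 := hT.hasSum.prod_fiberwise (fun i => h3 i y hy)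
    have e2 := ((Equiv.prodComm ℕ ℕ).hasSum_iff.2 hT.hasSum).prod_fiberwise
      (g := fun m => (∑' i, p i m) (fun _ => y))
      (fun m => ContinuousMultilinearMap.hasSum_eval (hsum m).hasSum (fun _ => y))
    have e3 : (∑' i, g i y) = _ := e1.tsum_eq
    show HasSum (fun m => (∑' i, p i m) (fun _ => y)) (∑' i, g i y)
    rw [e3]
    exact e2

lemma NB.analyticAt {r K : ℝ} {g : E → ℝ} (hr : 0 < r) (h : NB r K g) : AnalyticAt ℝ g 0 := by
  obtain ⟨p, h1, h2, h3⟩ := h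
  lift r to NNReal using hr.le
  refine ⟨p, r, p.le_radius_of_summable h1, by exact_mod_cast hr, ?_⟩
  intro y hy
  rw [zero_add]
  apply h3
  simpa [Metric.eball_coe] using hy
end NBsec

lemma norm_proj_le (n : ℕ) (i : Fin n) :
    ‖(EuclideanSpace.proj i : EuclideanSpace ℝ (Fin n) →L[ℝ] ℝ)‖ ≤ 1 := by
  refine ContinuousLinearMap.opNorm_le_bound _ zero_le_one fun x => ?_
  simpa using PiLp.norm_apply_le x i

lemma NB.coord {n : ℕ} {r K : ℝ} {g : EuclideanSpace ℝ (Fin n) → ℝ} (hr : 0 < r) (i : Fin n)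
    (h : NB r K g) : NB r (r * K) (fun y => y i * g y) :=
  NB.coord_mul hr (EuclideanSpace.proj i) (norm_proj_le n i) h

lemma div_homog (n : ℕ) (i0 : Fin n) (S : Finset (Fin n)) (hS : i0 ∉ S) {r : ℝ} (hr : 0 < r)
    (m : ℕ) : ∀ M : ContinuousMultilinearMap ℝ (fun _ : Fin m => EuclideanSpace ℝ (Fin n)) ℝ,
    ∃ A R0 R1 : EuclideanSpace ℝ (Fin n) → ℝ,
      NB r (‖M‖ * ((2 * n + 1) * r) ^ m / r ^ 2) A ∧
      NB r (‖M‖ * ((2 * n + 1) * r) ^ m) R0 ∧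
      NB r (‖M‖ * ((2 * n + 1) * r) ^ m / r) R1 ∧
      (∀ (y : EuclideanSpace ℝ (Fin n)) (t : ℝ), R0 (y + t • EuclideanSpace.single i0 (1 : ℝ)) = R0 y) ∧
      (∀ (y : EuclideanSpace ℝ (Fin n)) (t : ℝ), R1 (y + t • EuclideanSpace.single i0 (1 : ℝ)) = R1 y) ∧
      ∀ y, M (fun _ => y) = A y * (y i0 ^ 2 + ∑ i ∈ S, y i ^ 2) + R0 y + R1 y * y i0 := by
  induction m with
  | zero =>
    intro M
    refine ⟨fun _ => 0, fun y => M (fun _ => y), fun _ => 0, ?_, ?_, ?_, ?_, ?_, ?_⟩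
    · exact NB.zero.mono (by positivity)
    · exact (NB.const M).mono (by simp)
    · exact NB.zero.mono (by positivity)
    · intro y t
      exact congrArg M (Subsingleton.elim _ _)
    · intros; rfl
    · intro y; ring
  | succ m ih =>
    intro M
    let Mi : Fin n → ContinuousMultilinearMap ℝ (fun _ : Fin m => EuclideanSpace ℝ (Fin n)) ℝ :=
      fun i => M.curryLeft (EuclideanSpace.single i 1)
    have hMi : ∀ i, ‖Mi i‖ ≤ ‖M‖ := by
      intro i
      have := (M.curryLeft).le_opNorm (EuclideanSpace.single i 1)
      rw [ContinuousMultilinearMap.curryLeft_norm] at this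
      simpa using this
    choose A R0 R1 hA hR0 hR1 hI0 hI1 hE using fun i => ih (Mi i)
    set X : ℝ := ‖M‖ * ((2 * n + 1) * r) ^ m with hX
    have hX0 : 0 ≤ X := by positivity
    have hXi : ∀ i, ‖Mi i‖ * ((2 * n + 1) * r) ^ m ≤ X := fun i => by
      have := hMi i
      rw [hX]; gcongr
    have hA' : ∀ i, NB r (X / r ^ 2) (A i) := fun i => (hA i).mono (by have := hXi i; gcongr)
    have hR0' : ∀ i, NB r X (R0 i) := fun i => (hR0 i).mono (hXi i)
    have hR1' : ∀ i, NB r (X / r) (R1 i) := fun i => (hR1 i).mono (by have := hXi i; gcongr)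
    have hc : ∀ T : Finset (Fin n), (T.card : ℝ) ≤ n := fun T => by
      exact_mod_cast (Finset.card_le_univ T).trans_eq (Fintype.card_fin n)
    have hXs : ‖M‖ * ((2 * n + 1) * r) ^ (m + 1) = (2 * n + 1) * r * X := by rw [hX]; ring
    have hco : ∀ (i : Fin n) (y : EuclideanSpace ℝ (Fin n)) (t : ℝ), i ≠ i0 →
        (y + t • EuclideanSpace.single i0 (1 : ℝ)) i = y i := by
      intro i y t hi
      simp [hi]
    rw [hXs]
    refine ⟨fun y => (∑ i, y i * A i y) + R1 i0 y,
      fun y => (∑ i ∈ Finset.univ.erase i0, y i * R0 i y) +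
        ∑ i ∈ S, -(y i * (y i * R1 i0 y)),
      fun y => (∑ i ∈ Finset.univ.erase i0, y i * R1 i y) + R0 i0 y, ?_, ?_, ?_, ?_, ?_, ?_⟩
    · refine (NB.add hr (NB.sum _ hr fun i _ => (hA' i).coord hr i) (hR1' i0)).mono ?_
      simp only [Finset.sum_const, nsmul_eq_mul, Finset.card_univ, Fintype.card_fin]
      have e : (n : ℝ) * (r * (X / r ^ 2)) + X / r = (n + 1) * (X / r) := by field_simp
      have e' : (2 * n + 1) * r * X / r ^ 2 = (2 * n + 1) * (X / r) := by field_simp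
      rw [e, e']
      gcongr
      linarith [(Nat.cast_nonneg n : (0 : ℝ) ≤ n)]
    · refine (NB.add hr (NB.sum _ hr fun i _ => (hR0' i).coord hr i)
        (NB.sum _ hr fun i _ => (((hR1' i0).coord hr i).coord hr i).neg)).mono ?_
      simp only [Finset.sum_const, nsmul_eq_mul]
      have e : r * (r * (X / r)) = r * X := by field_simp
      rw [e]
      have h1 := mul_le_mul_of_nonneg_right (hc (Finset.univ.erase i0)) (mul_nonneg hr.le hX0)
      have h2 := mul_le_mul_of_nonneg_right (hc S) (mul_nonneg hr.le hX0)
      nlinarith [mul_nonneg hr.le hX0]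
    · refine (NB.add hr (NB.sum _ hr fun i _ => (hR1' i).coord hr i) (hR0' i0)).mono ?_
      simp only [Finset.sum_const, nsmul_eq_mul]
      have e : r * (X / r) = X := by field_simp
      have e' : (2 * n + 1) * r * X / r = (2 * n + 1) * X := by field_simp
      rw [e, e']
      have h1 := mul_le_mul_of_nonneg_right (hc (Finset.univ.erase i0)) hX0
      nlinarith [mul_nonneg (Nat.cast_nonneg n : (0 : ℝ) ≤ n) hX0]
    · intro y t
      dsimp only
      congr 1
      · refine Finset.sum_congr rfl fun i hi => ?_
        rw [hco i y t (Finset.ne_of_mem_erase hi), hI0]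
      · refine Finset.sum_congr rfl fun i hi => ?_
        rw [hco i y t (fun h => hS (h ▸ hi)), hI1]
    · intro y t
      dsimp only
      congr 1
      · refine Finset.sum_congr rfl fun i hi => ?_
        rw [hco i y t (Finset.ne_of_mem_erase hi), hI1]
      · rw [hI0]
    · intro y
      have hy : y = ∑ i, y i • EuclideanSpace.single i (1 : ℝ) := by
        ext j
        simp [Finset.sum_apply, Pi.single_apply]
      have h1 : M (fun _ => y) = ∑ i, y i * Mi i (fun _ => y) := by
        have : M (fun _ => y) = M.curryLeft y (fun _ => y) := by
          rw [ContinuousMultilinearMap.curryLeft_apply]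
          congr 1
          funext j
          refine Fin.cases rfl (fun _ => rfl) j
        rw [this]
        conv_lhs => rw [show M.curryLeft y = M.curryLeft (∑ i, y i • EuclideanSpace.single i (1 : ℝ)) from congrArg _ hy]
        simp only [map_sum, map_smul, ContinuousMultilinearMap.sum_apply,
          ContinuousMultilinearMap.smul_apply, smul_eq_mul, Mi]
      rw [h1]
      dsimp only
      simp only [hE]
      rw [← Finset.add_sum_erase _ _ (Finset.mem_univ i0),
        ← Finset.add_sum_erase _ (fun i => y i * A i y) (Finset.mem_univ i0)]
      have e1 : ∑ i ∈ Finset.univ.erase i0, y i * (A i y * (y i0 ^ 2 + ∑ i ∈ S, y i ^ 2) + R0 i y +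
          R1 i y * y i0) = (∑ i ∈ Finset.univ.erase i0, y i * A i y) *
          (y i0 ^ 2 + ∑ i ∈ S, y i ^ 2) + (∑ i ∈ Finset.univ.erase i0, y i * R0 i y) +
          (∑ i ∈ Finset.univ.erase i0, y i * R1 i y) * y i0 := by
        rw [Finset.sum_mul, Finset.sum_mul, ← Finset.sum_add_distrib, ← Finset.sum_add_distrib]
        exact Finset.sum_congr rfl fun i _ => by ring
      have e2 : ∑ i ∈ S, -(y i * (y i * R1 i0 y)) = - ((∑ i ∈ S, y i ^ 2) * R1 i0 y) := by
        rw [Finset.sum_mul, ← Finset.sum_neg_distrib]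
        exact Finset.sum_congr rfl fun i _ => by ring
      rw [e1, e2]
      ring

/-- Weierstrass division by `y i0 ^ 2 + ∑ i ∈ S, y i ^ 2`. -/
lemma div_analytic (n : ℕ) (i0 : Fin n) (S : Finset (Fin n)) (hS : i0 ∉ S)
    (f : EuclideanSpace ℝ (Fin n) → ℝ) (hf : AnalyticAt ℝ f 0) :
    ∃ A R0 R1 : EuclideanSpace ℝ (Fin n) → ℝ, AnalyticAt ℝ A 0 ∧
      (∀ (y : EuclideanSpace ℝ (Fin n)) (t : ℝ), R0 (y + t • EuclideanSpace.single i0 (1 : ℝ)) = R0 y) ∧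
      (∀ (y : EuclideanSpace ℝ (Fin n)) (t : ℝ), R1 (y + t • EuclideanSpace.single i0 (1 : ℝ)) = R1 y) ∧
      ∀ᶠ y in nhds 0, f y = A y * (y i0 ^ 2 + ∑ i ∈ S, y i ^ 2) + R0 y + R1 y * y i0 := by
  obtain ⟨p, ρ, hp⟩ := hf
  obtain ⟨s, hs0, hs⟩ := ENNReal.lt_iff_exists_nnreal_btwn.1 (hp.r_pos)
  have hs0' : (0 : ℝ) < s := by exact_mod_cast hs0
  have hsum := p.summable_norm_mul_pow (hs.trans_le hp.r_le)
  set r : ℝ := s / (2 * n + 1) with hr_def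
  have hr : 0 < r := by positivity
  have hBr : (2 * n + 1) * r = s := by rw [hr_def]; field_simp
  have hrs : r ≤ s := by
    rw [hr_def]
    apply div_le_self hs0'.le
    linarith [(Nat.cast_nonneg n : (0 : ℝ) ≤ n)]
  choose A R0 R1 hA hR0 hR1 hI0 hI1 hE using fun m => div_homog n i0 S hS hr m (p m)
  simp only [hBr] at hA hR0 hR1
  refine ⟨fun y => ∑' m, A m y, fun y => ∑' m, R0 m y, fun y => ∑' m, R1 m y, ?_, ?_, ?_, ?_⟩
  · exact (NB.tsum hr hA (hsum.div_const _)).analyticAt hr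
  · intro y t
    simp only [hI0]
  · intro y t
    simp only [hI1]
  · filter_upwards [Metric.ball_mem_nhds 0 hr] with y hy
    rw [mem_ball_zero_iff] at hy
    have h1 : Summable (fun m => A m y) :=
      Summable.of_norm_bounded (hsum.div_const _) (fun m => (hA m).abs_le hy)
    have h2 : Summable (fun m => R0 m y) :=
      Summable.of_norm_bounded hsum (fun m => (hR0 m).abs_le hy)
    have h3 : Summable (fun m => R1 m y) :=
      Summable.of_norm_bounded (hsum.div_const _) (fun m => (hR1 m).abs_le hy)
    have h4 := ((h1.hasSum.mul_right (y i0 ^ 2 + ∑ i ∈ S, y i ^ 2)).add h2.hasSum).add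
      (h3.hasSum.mul_right (y i0))
    have h5 : HasSum (fun m => p m (fun _ => y)) (f y) := by
      have := hp.hasSum (y := y) (by
        refine Metric.eball_subset_eball hs.le ?_
        rw [Metric.eball_coe, mem_ball_zero_iff]
        exact hy.trans_le hrs)
      simpa using this
    simp only [hE] at h5
    exact h5.unique h4

/-- One variable step: if `(s² + t²) G(t) = (a + b t)³` for small real `t` with `G` a power series
converging beyond `s > 0`, then `a = b = 0`. -/
lemma one_var (g : ℕ → ℝ) (δ s a b : ℝ) (hs : 0 < s) (hsδ : s < δ)
    (hg : Summable fun k => |g k| * δ ^ k)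
    (h : ∀ t : ℝ, |t| < δ → (t ^ 2 + s ^ 2) * (∑' k, g k * t ^ k) = (a + b * t) ^ 3) :
    a = 0 ∧ b = 0 := by
  have hδ : 0 < δ := hs.trans hsδ
  let H : ℂ → ℂ := fun z => ∑' k, (g k : ℂ) * z ^ k
  have hH : DifferentiableOn ℂ H (Metric.ball 0 δ) := by
    refine Complex.differentiableOn_tsum_of_summable_norm hg (fun k => by fun_prop)
      Metric.isOpen_ball ?_
    intro k z hz
    rw [mem_ball_zero_iff] at hz
    rw [norm_mul, norm_pow, Complex.norm_real, Real.norm_eq_abs]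
    gcongr
  let W : ℂ → ℂ := fun z => (z ^ 2 + (s : ℂ) ^ 2) * H z - (a + b * z) ^ 3
  have hW : DifferentiableOn ℂ W (Metric.ball 0 δ) := by
    have h1 : Differentiable ℂ (fun z : ℂ => z ^ 2 + (s : ℂ) ^ 2) := by fun_prop
    have h2 : Differentiable ℂ (fun z : ℂ => ((a : ℂ) + b * z) ^ 3) := by fun_prop
    exact (h1.differentiableOn.mul hH).sub h2.differentiableOn
  have hWr : ∀ t : ℝ, |t| < δ → W t = 0 := by
    intro t ht
    have h1 : H t = ((∑' k, g k * t ^ k : ℝ) : ℂ) := by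
      simp [H, Complex.ofReal_tsum]
    have h2 := h t ht
    show ((t : ℂ) ^ 2 + (s : ℂ) ^ 2) * H t - (a + b * t) ^ 3 = 0
    rw [h1, sub_eq_zero]
    exact_mod_cast h2
  have hfr : ∃ᶠ z in nhdsWithin (0 : ℂ) {0}ᶜ, W z = 0 := by
    have ht : Filter.Tendsto (fun t : ℝ => (t : ℂ)) (nhdsWithin 0 {0}ᶜ) (nhdsWithin (0 : ℂ) {0}ᶜ) := by
      refine tendsto_nhdsWithin_iff.2 ⟨?_, ?_⟩
      · have : Filter.Tendsto (fun t : ℝ => (t : ℂ)) (nhds 0) (nhds ((0 : ℝ) : ℂ)) :=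
          Complex.continuous_ofReal.tendsto 0
        rw [Complex.ofReal_zero] at this
        exact this.mono_left nhdsWithin_le_nhds
      · filter_upwards [self_mem_nhdsWithin] with t ht
        simpa using ht
    refine ht.frequently (Filter.Eventually.frequently ?_)
    filter_upwards [nhdsWithin_le_nhds (Metric.ball_mem_nhds (0 : ℝ) hδ)] with t ht
    refine hWr t ?_
    simpa using ht
  have hz := (hW.analyticOnNhd Metric.isOpen_ball).eqOn_zero_of_preconnected_of_frequently_eq_zero
    (convex_ball (0 : ℂ) δ).isPreconnected (Metric.mem_ball_self hδ) hfr
  have hmem : Complex.I * s ∈ Metric.ball (0 : ℂ) δ := by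
    rw [mem_ball_zero_iff]
    simpa [abs_of_pos hs] using hsδ
  have h1 : ((Complex.I * s) ^ 2 + (s : ℂ) ^ 2) * H (Complex.I * s) - (a + b * (Complex.I * s)) ^ 3 = 0 :=
    hz hmem
  rw [mul_pow, Complex.I_sq] at h1
  have h2 : ((a : ℂ) + b * (Complex.I * s)) ^ 3 = 0 := by linear_combination -h1
  have h3 := pow_eq_zero_iff (three_ne_zero) |>.1 h2
  have hre := congrArg Complex.re h3
  have him := congrArg Complex.im h3
  simp at hre him
  exact ⟨hre, him.resolve_right hs.ne'⟩

/-- Along a line close to the centre, an analytic function is a power series with a uniform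
radius. -/
lemma line_series {E : Type*} [NormedAddCommGroup E] [NormedSpace ℝ E] (G : E → ℝ)
    (hG : AnalyticAt ℝ G 0) : ∃ δ > 0, ∀ y e : E, ‖y‖ < δ → ‖e‖ ≤ 1 → ∃ g : ℕ → ℝ,
      (Summable fun k => |g k| * δ ^ k) ∧ ∀ t : ℝ, |t| < δ → HasSum (fun k => g k * t ^ k) (G (y + t • e)) := by
  obtain ⟨p, ρ, hp⟩ := hG
  obtain ⟨s, hs0, hs⟩ := ENNReal.lt_iff_exists_nnreal_btwn.1 (hp.r_pos)
  have hs0' : (0 : ℝ) < s := by exact_mod_cast hs0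
  refine ⟨s / 2, by positivity, ?_⟩
  intro y e hy he
  have hys : ‖y‖₊ < s / 2 := by
    rw [← NNReal.coe_lt_coe]; simpa using hy
  have hy2 : (‖y‖₊ : ENNReal) < ρ := by
    refine lt_trans ?_ hs
    exact_mod_cast hys.trans_le (half_le_self s.2)
  have hq := hp.changeOrigin hy2
  rw [zero_add] at hq
  set q := p.changeOrigin y
  have hrad : ((s / 2 : NNReal) : ENNReal) < ρ - ‖y‖₊ := by
    rw [lt_tsub_iff_right]
    refine lt_trans ?_ hs
    rw [← ENNReal.coe_add, ENNReal.coe_lt_coe]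
    calc s / 2 + ‖y‖₊ < s / 2 + s / 2 := by gcongr
      _ = s := add_halves s
  have hsum := q.summable_norm_mul_pow (hrad.trans_le hq.r_le)
  refine ⟨fun k => q k (fun _ => e), ?_, ?_⟩
  · refine Summable.of_nonneg_of_le (fun k => by positivity) (fun k => ?_) hsum
    push_cast
    gcongr
    rw [← Real.norm_eq_abs]
    refine ((q k).le_opNorm _).trans ?_
    simp only [Finset.prod_const, Finset.card_univ, Fintype.card_fin]
    exact mul_le_of_le_one_right (norm_nonneg _) (pow_le_one₀ (norm_nonneg _) he)
  · intro t ht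
    have := hq.hasSum (y := t • e) (by
      refine Metric.eball_subset_eball hrad.le ?_
      rw [Metric.eball_coe, mem_ball_zero_iff, norm_smul, Real.norm_eq_abs]
      push_cast
      exact (mul_le_of_le_one_right (abs_nonneg _) he).trans_lt ht)
    have e1 : (fun k => q k (fun _ => e) * t ^ k) = fun k => q k (fun _ => t • e) := by
      funext k
      have h2 := (q k).map_smul_univ (fun _ => t) (fun _ => e)
      rw [h2]
      simp [mul_comm]
    rw [e1]
    exact this

open Classical in
/-- For `Y = {x ∈ ℝⁿ : x₁ = ⋯ = x_c = 0}` of codimension `c ≥ 2`,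
`d²(x) = x₁² + ⋯ + x_c²`, and `f : ℝⁿ → ℝ` real analytic vanishing on `Y`, if the germ
of `f` at `p ∈ Y` is not divisible by the germ of `d²` at `p`, then the function
`F = f³/d²` (with `F = 0` on `Y`) is not real analytic at `p`. -/
theorem stmt_19
    (n c : ℕ) (hn : 2 ≤ n) (hc2 : 2 ≤ c) (hcn : c ≤ n)
    (Y : Set (EuclideanSpace ℝ (Fin n)))
    (hY : Y = {x : EuclideanSpace ℝ (Fin n) | ∀ i : Fin n, (i : ℕ) < c → x i = 0})
    (d2 : EuclideanSpace ℝ (Fin n) → ℝ)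
    (hd2 : ∀ x : EuclideanSpace ℝ (Fin n),
      d2 x = ∑ i ∈ Finset.univ.filter (fun i : Fin n => (i : ℕ) < c), x i ^ 2)
    (f : EuclideanSpace ℝ (Fin n) → ℝ)
    (hf : ∀ x, AnalyticAt ℝ f x) (hfY : ∀ x ∈ Y, f x = 0)
    (p : EuclideanSpace ℝ (Fin n)) (hp : p ∈ Y)
    (hnotdiv : ¬ ∃ (a : EuclideanSpace ℝ (Fin n) → ℝ) (U : Set (EuclideanSpace ℝ (Fin n))),
      IsOpen U ∧ p ∈ U ∧ (∀ x ∈ U, AnalyticAt ℝ a x) ∧ ∀ x ∈ U, f x = a x * d2 x)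
    (F : EuclideanSpace ℝ (Fin n) → ℝ)
    (hF : ∀ x, F x = if x ∈ Y then 0 else f x ^ 3 / d2 x) :
    ¬ AnalyticAt ℝ F p := by
  intro hFan
  apply hnotdiv
  subst hY
  set i0 : Fin n := ⟨0, by omega⟩ with hi0
  set i1 : Fin n := ⟨1, by omega⟩ with hi1
  set T : Finset (Fin n) := Finset.univ.filter (fun i : Fin n => (i : ℕ) < c) with hT
  have hi0T : i0 ∈ T := by simp [hT, hi0]; omega
  set S := T.erase i0 with hSdef
  have hi0S : i0 ∉ S := Finset.notMem_erase _ _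
  have hi1S : i1 ∈ S := by
    simp [hSdef, hT, hi0, hi1]; omega
  have hdS : ∀ y, d2 y = y i0 ^ 2 + ∑ i ∈ S, y i ^ 2 := by
    intro y
    rw [hd2, hSdef, Finset.add_sum_erase T (fun i => y i ^ 2) hi0T]
  have hpT : ∀ i ∈ T, p i = 0 := by
    intro i hi
    exact hp i (by simpa [hT] using hi)
  have hdp : ∀ y, d2 (p + y) = d2 y := by
    intro y
    rw [hd2, hd2]
    refine Finset.sum_congr rfl fun i hi => ?_
    simp [hpT i hi]
  have hmul : ∀ x, f x ^ 3 = F x * d2 x := by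
    intro x
    rw [hF]
    split_ifs with hx
    · rw [hfY x hx]; simp
    · have : d2 x ≠ 0 := by
        intro h0
        apply hx
        rw [hd2, Finset.sum_eq_zero_iff_of_nonneg (fun i _ => sq_nonneg _)] at h0
        intro i hi
        exact pow_eq_zero_iff two_ne_zero |>.1 (h0 i (by simpa [hT] using hi))
      field_simp
  have hshift : AnalyticAt ℝ (fun y : EuclideanSpace ℝ (Fin n) => p + y) 0 := by fun_prop
  have hf0 : AnalyticAt ℝ (fun y => f (p + y)) 0 :=
    AnalyticAt.fun_comp (g := f) (hf _) hshift
  have hF0 : AnalyticAt ℝ (fun y => F (p + y)) 0 :=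
    AnalyticAt.fun_comp (g := F) (by simpa using hFan) hshift
  have hcoord : ∀ (i : Fin n) (y : EuclideanSpace ℝ (Fin n)),
      AnalyticAt ℝ (fun y : EuclideanSpace ℝ (Fin n) => y i) y := fun i y =>
    (EuclideanSpace.proj i : EuclideanSpace ℝ (Fin n) →L[ℝ] ℝ).analyticAt y
  have hd2an : ∀ y, AnalyticAt ℝ d2 y := by
    intro y
    have : d2 = fun x => ∑ i ∈ T, x i ^ 2 := funext hd2
    rw [this]
    exact Finset.analyticAt_fun_sum T fun i _ => (hcoord i y).pow 2
  obtain ⟨A, R0, R1, hA, hI0, hI1, hdiv⟩ := div_analytic n i0 S hi0S _ hf0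
  have hG : AnalyticAt ℝ (fun y => F (p + y) - 3 * f (p + y) ^ 2 * A y
      + 3 * f (p + y) * A y ^ 2 * d2 y - A y ^ 3 * d2 y ^ 2) 0 := by
    have hd := hd2an 0
    exact ((hF0.sub ((analyticAt_const.mul (hf0.pow 2)).mul hA)).add
      (((analyticAt_const.mul hf0).mul (hA.pow 2)).mul hd)).sub ((hA.pow 3).mul (hd.pow 2))
  obtain ⟨δ, hδ, hline⟩ := line_series _ hG
  obtain ⟨ε, hε, hball⟩ := Metric.eventually_nhds_iff.1 (hdiv.and hA.eventually_analyticAt)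
  simp only [dist_zero_right] at hball
  set δ' : ℝ := min δ (ε / 2) with hδ'
  have hδ'0 : 0 < δ' := by positivity
  have hδ'1 : δ' ≤ δ := min_le_left _ _
  have hδ'2 : δ' ≤ ε / 2 := min_le_right _ _
  have hsing : ∀ i : Fin n, ‖(EuclideanSpace.single i (1 : ℝ) : EuclideanSpace ℝ (Fin n))‖ = 1 := by
    intro i; simp
  have key : ∀ y : EuclideanSpace ℝ (Fin n), ‖y‖ < δ' / 2 → (∑ i ∈ S, y i ^ 2) ≠ 0 →
      f (p + y) = A y * d2 y := by
    intro y hy hq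
    set e : EuclideanSpace ℝ (Fin n) := EuclideanSpace.single i0 (1 : ℝ) with he
    set y' := y + (-(y i0)) • e with hy'
    have hy'n : ‖y'‖ < δ' := by
      have h1 : ‖y'‖ ≤ ‖y‖ + ‖(-(y i0)) • e‖ := norm_add_le _ _
      rw [norm_smul, norm_neg, hsing i0, mul_one] at h1
      have h2 := PiLp.norm_apply_le y i0
      linarith
    have hy'0 : y' i0 = 0 := by simp [hy', he]
    have hSne : ∀ i ∈ S, i ≠ i0 := fun i hi h => hi0S (h ▸ hi)
    have hcoe : ∀ (x : EuclideanSpace ℝ (Fin n)) (t : ℝ), ∀ i ∈ S, (x + t • e) i = x i := by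
      intro x t i hi
      simp [he, hSne i hi]
    have hq' : ∀ (x : EuclideanSpace ℝ (Fin n)) (t : ℝ),
        ∑ i ∈ S, (x + t • e) i ^ 2 = ∑ i ∈ S, x i ^ 2 := fun x t =>
      Finset.sum_congr rfl fun i hi => by rw [hcoe x t i hi]
    set q := ∑ i ∈ S, y i ^ 2 with hqdef
    have hq0 : 0 < q := lt_of_le_of_ne (Finset.sum_nonneg fun i _ => sq_nonneg _) (Ne.symm hq)
    have hqn : q ≤ ‖y'‖ ^ 2 := by
      rw [EuclideanSpace.real_norm_sq_eq, hqdef, ← hq' y (-(y i0))]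
      exact Finset.sum_le_univ_sum_of_nonneg fun i => sq_nonneg _
    have hs1 : Real.sqrt q < δ' :=
      (Real.sqrt_le_sqrt hqn).trans_lt (by rwa [Real.sqrt_sq (norm_nonneg _)])
    obtain ⟨g, hg1, hg2⟩ := hline y' e (hy'n.trans_le hδ'1) (hsing i0).le
    have hR := one_var g δ' (Real.sqrt q) (R0 y') (R1 y') (Real.sqrt_pos.2 hq0) hs1
      (Summable.of_nonneg_of_le (fun k => by positivity) (fun k => by gcongr) hg1) (by
        intro t ht
        rw [(hg2 t (ht.trans_le hδ'1)).tsum_eq, Real.sq_sqrt hq0.le]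
        have hn : ‖y' + t • e‖ < ε := by
          have h1 : ‖y' + t • e‖ ≤ ‖y'‖ + ‖t • e‖ := norm_add_le _ _
          rw [norm_smul, hsing i0, mul_one, Real.norm_eq_abs] at h1
          linarith
        have h1 := (hball hn).1
        have h2 := hmul (p + (y' + t • e))
        rw [hdp] at h2
        have h3 : d2 (y' + t • e) = t ^ 2 + q := by
          rw [hdS, hq', hy', hq']
          simp [he, hqdef]
        have h4 : (y' + t • e) i0 = t := by
          rw [PiLp.add_apply, hy'0]; simp [he]
        rw [← hdS, hI0, hI1, h4] at h1
        rw [h3] at h1 h2 ⊢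
        have h5 : R0 y' + R1 y' * t = f (p + (y' + t • e)) - A (y' + t • e) * (t ^ 2 + q) := by
          linarith
        rw [h5]
        linear_combination -h2)
    have h1 := (hball (y := y) (by linarith)).1
    rw [hy', hI0, hI1] at hR
    rw [hR.1, hR.2, ← hdS] at h1
    linarith
  have key2 : ∀ y : EuclideanSpace ℝ (Fin n), ‖y‖ < δ' / 2 → f (p + y) = A y * d2 y := by
    intro y hy
    by_cases hq : (∑ i ∈ S, y i ^ 2) = 0
    swap
    · exact key y hy hq
    set e : EuclideanSpace ℝ (Fin n) := EuclideanSpace.single i1 (1 : ℝ) with he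
    have hl : Continuous (fun t : ℝ => y + t • e) := by fun_prop
    have hl0 : y + (0 : ℝ) • e = y := by simp
    have hAy : ContinuousAt A (y + (0 : ℝ) • e) := by
      rw [hl0]; exact ((hball (y := y) (by linarith)).2).continuousAt
    have hdy : ContinuousAt d2 (y + (0 : ℝ) • e) := (hd2an _).continuousAt
    have hfy : ContinuousAt (fun y => f (p + y)) (y + (0 : ℝ) • e) :=
      ContinuousAt.comp' (g := f) (hf _).continuousAt (by fun_prop)
    have c1 : ContinuousAt (fun t : ℝ => f (p + (y + t • e))) 0 :=
      ContinuousAt.comp' (g := fun y => f (p + y)) (f := fun t : ℝ => y + t • e) hfy hl.continuousAt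
    have c2 : ContinuousAt (fun t : ℝ => A (y + t • e) * d2 (y + t • e)) 0 :=
      ContinuousAt.comp' (g := fun y => A y * d2 y) (f := fun t : ℝ => y + t • e)
        (hAy.mul hdy) hl.continuousAt
    have hev : ∀ᶠ t in nhdsWithin (0 : ℝ) {0}ᶜ,
        f (p + (y + t • e)) = A (y + t • e) * d2 (y + t • e) := by
      have hn : ∀ᶠ t in nhds (0 : ℝ), ‖y + t • e‖ < δ' / 2 := by
        have : ContinuousAt (fun t : ℝ => ‖y + t • e‖) 0 := hl.norm.continuousAt
        exact this.eventually_lt_const (by simpa using hy)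
      filter_upwards [nhdsWithin_le_nhds hn, self_mem_nhdsWithin] with t ht ht0
      refine key _ ht ?_
      have hyi : y i1 = 0 := by
        rw [Finset.sum_eq_zero_iff_of_nonneg (fun i _ => sq_nonneg _)] at hq
        exact pow_eq_zero_iff two_ne_zero |>.1 (hq i1 hi1S)
      intro h0
      rw [Finset.sum_eq_zero_iff_of_nonneg (fun i _ => sq_nonneg _)] at h0
      have := pow_eq_zero_iff two_ne_zero |>.1 (h0 i1 hi1S)
      rw [PiLp.add_apply, hyi] at this
      apply ht0
      simpa [he] using this
    have l1 := c1.tendsto.mono_left (nhdsWithin_le_nhds (s := {0}ᶜ))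
    have l2 := c2.tendsto.mono_left (nhdsWithin_le_nhds (s := {0}ᶜ))
    have := tendsto_nhds_unique (l1.congr' hev) l2
    simpa using this
  refine ⟨fun x => A (x - p), Metric.ball p (δ' / 2), Metric.isOpen_ball,
    Metric.mem_ball_self (by positivity), ?_, ?_⟩
  · intro x hx
    rw [mem_ball_iff_norm] at hx
    have h1 : AnalyticAt ℝ (fun x : EuclideanSpace ℝ (Fin n) => x - p) x := by fun_prop
    exact AnalyticAt.fun_comp (g := A) (hball (y := x - p) (by linarith)).2 h1
  · intro x hx
    rw [mem_ball_iff_norm] at hx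
    have h1 := key2 (x - p) hx
    have h2 := hdp (x - p)
    rw [add_sub_cancel] at h1 h2
    rw [h1, h2]
end
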